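/- arXiv:0802.4195 — 5 statements merged into one kernel-verified Lean document; each statement's English description precedes it below -/
import Mathlib

section
/- Let N ≥ 1 and let A and C be real symmetric N×N matrices, each having N distinct eigenvalues. Then the set { O ∈ SO(N) : (O A Oᵀ)·C = C·(O A Oᵀ) } is finite and has exactly 2^{N−1}·N! elements. (These are exactly the critical points of the function g(O) = tr(Cᵀ O A Oᵀ) on the special orthogonal group.) -/
open Matrix Equiv

/-- The signed permutation matrix whose only nonzero entry in row `i` is `s i`, in column `σ i`. -/
def signedPermMatrix {n : Type*} [DecidableEq n] [Fintype n] (x : Perm n × (n → ℤˣ)) :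
    Matrix n n ℝ :=
  diagonal (fun i => ((x.2 i : ℤ) : ℝ)) * x.1.permMatrix ℝ

section signedPermMatrix

variable {n : Type*} [DecidableEq n] [Fintype n]

lemma signedPermMatrix_apply (x : Perm n × (n → ℤˣ)) (i j : n) :
    signedPermMatrix x i j = if x.1 i = j then ((x.2 i : ℤ) : ℝ) else 0 := by
  simp [signedPermMatrix, diagonal_mul, PEquiv.toMatrix_apply]

lemma det_signedPermMatrix (x : Perm n × (n → ℤˣ)) :
    (signedPermMatrix x).det = (((∏ i, x.2 i) * Perm.sign x.1 : ℤˣ) : ℤ) := by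
  simp [signedPermMatrix, det_diagonal, det_permutation]

lemma units_int_cast_ne_zero (u : ℤˣ) : ((u : ℤ) : ℝ) ≠ 0 := by
  exact_mod_cast u.ne_zero

lemma units_int_cast_mul_self (u : ℤˣ) : ((u : ℤ) : ℝ) * ((u : ℤ) : ℝ) = 1 := by
  rw [← Int.cast_mul, ← Units.val_mul, Int.units_mul_self, Units.val_one, Int.cast_one]

lemma exists_units_int_cast_eq {r : ℝ} (h : r * r = 1) : ∃ u : ℤˣ, ((u : ℤ) : ℝ) = r := by
  rcases mul_self_eq_one_iff.mp h with rfl | rfl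
  · exact ⟨1, by simp⟩
  · exact ⟨-1, by simp⟩

lemma signedPermMatrix_injective :
    Function.Injective (signedPermMatrix : Perm n × (n → ℤˣ) → Matrix n n ℝ) := by
  rintro ⟨σ, s⟩ ⟨τ, t⟩ h
  have key (i : n) : τ i = σ i ∧ s i = t i := by
    have hi := congrFun (congrFun h i) (σ i)
    rw [signedPermMatrix_apply, signedPermMatrix_apply, if_pos rfl] at hi
    split_ifs at hi with hτ
    · exact ⟨hτ, Units.ext (by exact_mod_cast hi)⟩
    · exact absurd hi (units_int_cast_ne_zero _)
  refine Prod.ext (Equiv.ext fun i => (key i).1.symm) (funext fun i => (key i).2)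

lemma signedPermMatrix_mul_transpose (x : Perm n × (n → ℤˣ)) :
    signedPermMatrix x * (signedPermMatrix x)ᵀ = 1 := by
  ext i k
  simp only [mul_apply, transpose_apply, signedPermMatrix_apply, ite_mul, zero_mul,
    Finset.sum_ite_eq, Finset.mem_univ, if_true, EmbeddingLike.apply_eq_iff_eq, one_apply]
  rcases eq_or_ne i k with rfl | h
  · simpa using units_int_cast_mul_self _
  · simp [h, h.symm]

lemma signedPermMatrix_conj_diagonal (x : Perm n × (n → ℤˣ)) (d : n → ℝ) :
    signedPermMatrix x * diagonal d * (signedPermMatrix x)ᵀ = diagonal (d ∘ x.1) := by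
  have h : signedPermMatrix x * diagonal d = diagonal (d ∘ x.1) * signedPermMatrix x := by
    ext i j
    simp only [mul_diagonal, diagonal_mul, signedPermMatrix_apply, Function.comp_apply]
    split_ifs with hij
    · rw [hij, mul_comm]
    · simp
  rw [h, mul_assoc, signedPermMatrix_mul_transpose, mul_one]

/-- An orthogonal matrix conjugating a diagonal matrix with distinct entries to a diagonal matrix
is a signed permutation matrix. -/
lemma exists_signedPermMatrix_eq {R : Matrix n n ℝ} (hR : R * Rᵀ = 1) {d f : n → ℝ}
    (hd : Function.Injective d) (h : R * diagonal d * Rᵀ = diagonal f) :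
    ∃ x, signedPermMatrix x = R := by
  have hcomm : R * diagonal d = diagonal f * R := by
    rw [← h, mul_assoc _ Rᵀ R, mul_eq_one_comm.mp hR, mul_one]
  have hentry (i j : n) (hij : R i j ≠ 0) : d j = f i := by
    have := congrFun (congrFun hcomm i) j
    rw [mul_diagonal, diagonal_mul, mul_comm] at this
    exact mul_right_cancel₀ hij this
  have hrow (i : n) : ∃ j, R i j ≠ 0 := by
    by_contra! h0
    have := congrFun (congrFun hR i) i
    simp [mul_apply, h0] at this
  choose σ hσ using hrow
  have hzero (i j : n) (hij : σ i ≠ j) : R i j = 0 := by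
    by_contra h0
    exact hij (hd ((hentry i _ (hσ i)).trans (hentry i j h0).symm))
  have hdot (i k : n) : R i (σ i) * R k (σ i) = (1 : Matrix n n ℝ) i k := by
    rw [← hR, mul_apply]
    symm
    exact Finset.sum_eq_single (σ i)
      (fun j _ hj => by rw [hzero i j hj.symm, zero_mul]) (by simp)
  have hinj : Function.Injective σ := by
    intro i k hik
    by_contra hne
    have := hdot i k
    rw [one_apply_ne hne] at this
    exact mul_ne_zero (hσ i) (hik ▸ hσ k) this
  choose s hs using fun i => exists_units_int_cast_eq ((hdot i i).trans (one_apply_eq i))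
  refine ⟨(Equiv.ofBijective σ (Finite.injective_iff_bijective.mp hinj), s), ?_⟩
  ext i j
  rw [signedPermMatrix_apply]
  simp only [Equiv.ofBijective_apply]
  split_ifs with hij
  · rw [hs, hij]
  · exact (hzero i j hij).symm

end signedPermMatrix

lemma ncard_signs_perm (n : ℕ) (ε : ℤˣ) :
    {x : Perm (Fin (n + 1)) × (Fin (n + 1) → ℤˣ) | (∏ i, x.2 i) * Perm.sign x.1 = ε}.ncard =
      2 ^ n * (n + 1).factorial := by
  let F : Perm (Fin (n + 1)) × (Fin n → ℤˣ) → Perm (Fin (n + 1)) × (Fin (n + 1) → ℤˣ) :=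
    fun y => (y.1, Fin.cons (ε * (Perm.sign y.1)⁻¹ * (∏ i, y.2 i)⁻¹) y.2)
  have hF : F.Injective := by
    rintro ⟨σ, s⟩ ⟨τ, t⟩ h
    obtain ⟨h₁, h₂⟩ := Prod.mk.inj h
    exact Prod.ext h₁ (Fin.cons_injective2 h₂).2
  have himage : {x : Perm (Fin (n + 1)) × (Fin (n + 1) → ℤˣ) |
      (∏ i, x.2 i) * Perm.sign x.1 = ε} = F '' Set.univ := by
    ext ⟨σ, s⟩
    simp only [Set.mem_ofPred_eq, Set.image_univ, Set.mem_range]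
    constructor
    · rintro rfl
      refine ⟨(σ, Fin.tail s), Prod.ext rfl ?_⟩
      have htail : ∏ i, s i = s 0 * ∏ i, Fin.tail s i := Fin.prod_univ_succ s
      simp only [F, htail]
      rw [mul_inv_cancel_right, mul_inv_cancel_right, Fin.cons_self_tail]
    · rintro ⟨⟨τ, t⟩, h⟩
      obtain ⟨rfl, rfl⟩ := Prod.mk.inj h
      simp only [Fin.prod_univ_succ, Fin.cons_zero, Fin.cons_succ]
      rw [inv_mul_cancel_right, inv_mul_cancel_right]
  rw [himage, Set.ncard_image_of_injective _ hF, Set.ncard_univ]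
  simp [Nat.card_eq_fintype_card, Fintype.card_perm, mul_comm]

/-- Orthogonal diagonalization of a real symmetric matrix with distinct eigenvalues. -/
lemma exists_orthogonal_diagonalization {n : Type*} [DecidableEq n] [Fintype n]
    {A : Matrix n n ℝ} (hA : Aᵀ = A)
    (hAev : A.charpoly.roots.toFinset.card = Fintype.card n) :
    ∃ (P : Matrix n n ℝ) (d : n → ℝ), Pᵀ * P = 1 ∧ A = P * diagonal d * Pᵀ ∧
      Function.Injective d := by
  have hH : A.IsHermitian := by rwa [IsHermitian, conjTranspose_eq_transpose_of_trivial]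
  refine ⟨hH.eigenvectorUnitary, hH.eigenvalues, ?_, ?_, ?_⟩
  · simpa [star_eq_conjTranspose] using Unitary.coe_star_mul_self hH.eigenvectorUnitary
  · simpa [Unitary.conjStarAlgAut_apply, star_eq_conjTranspose, Function.comp_def] using
      hH.spectral_theorem
  · rw [hH.roots_charpoly_eq_eigenvalues] at hAev
    change (Finset.univ.image hH.eigenvalues).card = Finset.univ.card at hAev
    simpa using Finset.card_image_iff.mp hAev

/-- A matrix commuting with a diagonal matrix with distinct entries is diagonal. -/
lemma eq_diagonal_of_commute {n : Type*} [DecidableEq n] [Fintype n] {M : Matrix n n ℝ}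
    {e : n → ℝ} (he : Function.Injective e) (h : M * diagonal e = diagonal e * M) :
    M = diagonal M.diag := by
  ext i j
  rcases eq_or_ne i j with rfl | hij
  · simp
  · have := congrFun (congrFun h i) j
    rw [mul_diagonal, diagonal_mul, mul_comm] at this
    rw [diagonal_apply_ne _ hij]
    by_contra h0
    exact hij (he (mul_right_cancel₀ h0 this)).symm

/-- For real symmetric `N×N` matrices `A` and `C`, each with `N` distinct (real)
eigenvalues, the set of `O ∈ SO(N)` such that `O A Oᵀ` commutes with `C` — i.e. the set of
critical points of `g(O) = tr(Cᵀ O A Oᵀ)` on the special orthogonal group — is finite and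
has exactly `2^(N−1)·N!` elements. -/
theorem stmt6 (N : ℕ) (hN : 1 ≤ N) (A C : Matrix (Fin N) (Fin N) ℝ)
    (hA : Aᵀ = A) (hC : Cᵀ = C)
    (hAev : A.charpoly.roots.toFinset.card = N)
    (hCev : C.charpoly.roots.toFinset.card = N) :
    {O : Matrix (Fin N) (Fin N) ℝ | Oᵀ * O = 1 ∧ O.det = 1 ∧
        (O * A * Oᵀ) * C = C * (O * A * Oᵀ)}.Finite ∧
    {O : Matrix (Fin N) (Fin N) ℝ | Oᵀ * O = 1 ∧ O.det = 1 ∧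
        (O * A * Oᵀ) * C = C * (O * A * Oᵀ)}.ncard = 2 ^ (N - 1) * N.factorial := by
  obtain ⟨P, d, hP, rfl, hd⟩ := exists_orthogonal_diagonalization hA (by simpa using hAev)
  obtain ⟨Q, e, hQ, rfl, he⟩ := exists_orthogonal_diagonalization hC (by simpa using hCev)
  have hP' := mul_eq_one_comm.mp hP
  have hQ' := mul_eq_one_comm.mp hQ
  have hdetP : P.det * P.det = 1 := by simpa using congrArg det hP
  have hdetQ : Q.det * Q.det = 1 := by simpa using congrArg det hQ
  obtain ⟨ε, hε⟩ : ∃ ε : ℤˣ, ((ε : ℤ) : ℝ) = Q.det * P.det :=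
    exists_units_int_cast_eq (by linear_combination P.det * P.det * hdetQ + hdetP)
  let g (x : Perm (Fin N) × (Fin N → ℤˣ)) := Q * signedPermMatrix x * Pᵀ
  have hg : g.Injective := by
    intro x y hxy
    have key (z) : Qᵀ * g z * P = signedPermMatrix z := by
      simp only [g, mul_assoc, hP, mul_one]
      rw [← mul_assoc, hQ, one_mul]
    exact signedPermMatrix_injective (by rw [← key x, hxy, key y])
  have hconj (R : Matrix (Fin N) (Fin N) ℝ) :
      (Q * R * Pᵀ) * (P * diagonal d * Pᵀ) * (Q * R * Pᵀ)ᵀ = Q * (R * diagonal d * Rᵀ) * Qᵀ := by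
    simp only [transpose_mul, transpose_transpose, mul_assoc]
    simp only [← mul_assoc Pᵀ P, hP, one_mul]
  have hcomm (M : Matrix (Fin N) (Fin N) ℝ) :
      Q * M * Qᵀ * (Q * diagonal e * Qᵀ) = Q * diagonal e * Qᵀ * (Q * M * Qᵀ) ↔
        M * diagonal e = diagonal e * M := by
    have hmul (X Y : Matrix (Fin N) (Fin N) ℝ) :
        Q * X * Qᵀ * (Q * Y * Qᵀ) = Q * (X * Y) * Qᵀ := by
      simp only [mul_assoc]
      rw [← mul_assoc Qᵀ Q, hQ, one_mul]
    have hcancel (X : Matrix (Fin N) (Fin N) ℝ) : Qᵀ * (Q * X * Qᵀ) * Q = X := by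
      simp only [mul_assoc, hQ, mul_one]
      rw [← mul_assoc, hQ, one_mul]
    rw [hmul, hmul]
    refine ⟨fun h => ?_, fun h => by rw [h]⟩
    rw [← hcancel (M * _), h, hcancel]
  have hset : {O : Matrix (Fin N) (Fin N) ℝ | Oᵀ * O = 1 ∧ O.det = 1 ∧
      (O * (P * diagonal d * Pᵀ) * Oᵀ) * (Q * diagonal e * Qᵀ) =
        (Q * diagonal e * Qᵀ) * (O * (P * diagonal d * Pᵀ) * Oᵀ)} =
      g '' {x | (∏ i, x.2 i) * Perm.sign x.1 = ε} := by
    ext O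
    simp only [Set.mem_ofPred_eq, Set.mem_image]
    constructor
    · rintro ⟨hO, hdet, h⟩
      obtain ⟨R, rfl⟩ : ∃ R, O = Q * R * Pᵀ := by
        refine ⟨Qᵀ * O * P, ?_⟩
        simp only [mul_assoc, hP', mul_one]
        rw [← mul_assoc, hQ', one_mul]
      have hR : R * Rᵀ = 1 := by
        refine mul_eq_one_comm.mp ?_
        have := congrArg (fun X => Pᵀ * X * P) hO
        simp only [transpose_mul, transpose_transpose, mul_assoc, hP, mul_one] at this
        rwa [← mul_assoc Qᵀ Q, hQ, one_mul, ← mul_assoc Pᵀ P, hP, one_mul] at this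
      rw [hconj, hcomm] at h
      obtain ⟨x, rfl⟩ := exists_signedPermMatrix_eq hR hd (eq_diagonal_of_commute he h)
      refine ⟨x, ?_, rfl⟩
      rw [det_mul, det_mul, det_transpose, det_signedPermMatrix] at hdet
      refine Units.ext (Int.cast_injective (α := ℝ) ?_)
      rw [hε]
      generalize ((((∏ i, x.2 i) * Perm.sign x.1 : ℤˣ) : ℤ) : ℝ) = r at hdet ⊢
      linear_combination Q.det * P.det * hdet - r * P.det * P.det * hdetQ - r * hdetP
    · rintro ⟨x, hx, rfl⟩
      refine ⟨mul_eq_one_comm.mp ?_, ?_, ?_⟩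
      · simp only [g, transpose_mul, transpose_transpose, mul_assoc]
        rw [← mul_assoc Pᵀ P, hP, one_mul, ← mul_assoc _ _ Qᵀ, signedPermMatrix_mul_transpose,
          one_mul, hQ']
      · simp only [g]
        rw [det_mul, det_mul, det_transpose, det_signedPermMatrix, hx, hε]
        linear_combination P.det * P.det * hdetQ + hdetP
      · simp only [g]
        rw [hconj, hcomm, signedPermMatrix_conj_diagonal, diagonal_mul_diagonal,
          diagonal_mul_diagonal]
        simp only [mul_comm]
  rw [hset]
  refine ⟨(Set.toFinite _).image g, ?_⟩
  rw [Set.ncard_image_of_injective _ hg]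
  obtain ⟨n, rfl⟩ := Nat.exists_eq_succ_of_ne_zero (Nat.one_le_iff_ne_zero.mp hN)
  exact ncard_signs_perm n ε
end

section
/- Let N ≥ 1 and let A and C be Hermitian N×N complex matrices, each having N distinct eigenvalues. Then the set { X ∈ ℂ^{N×N} : X·C = C·X and X = U A U† for some N×N unitary matrix U } is finite and has exactly N! elements. (These are exactly the equilibrium points of the double-bracket flow Ẋ = [X,[X,C]] on the unitary orbit of A, namely the N! diagonalizations of A in the eigenbasis of C.) -/
open Matrix

theorem Function.Injective.exists_perm_eq_comp_of_map_univ_eq {n β : Type*} [Fintype n]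
    {a y : n → β} (ha : Function.Injective a)
    (h : Finset.univ.val.map y = Finset.univ.val.map a) : ∃ σ : Equiv.Perm n, y = a ∘ σ := by
  have hy : Function.Injective y := by
    rw [← Fintype.nodup_map_univ_iff_injective, h, Fintype.nodup_map_univ_iff_injective]
    exact ha
  have hmem (i : n) : ∃ j, a j = y i := by
    have hi : y i ∈ Finset.univ.val.map y := Multiset.mem_map_of_mem y (Finset.mem_univ i)
    rw [h] at hi
    obtain ⟨j, -, hj⟩ := Multiset.mem_map.mp hi
    exact ⟨j, hj⟩
  choose s hs using hmem
  have hsinj : Function.Injective s := fun i j hij => hy (by rw [← hs i, ← hs j, hij])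
  exact ⟨Equiv.ofBijective s (Finite.injective_iff_bijective.mp hsinj),
    funext fun i => (hs i).symm⟩

theorem Matrix.exists_unitary_diagonal_of_card_roots {N : ℕ} {A : Matrix (Fin N) (Fin N) ℂ}
    (hA : A.IsHermitian) (hcard : A.charpoly.roots.toFinset.card = N) :
    ∃ V ∈ unitaryGroup (Fin N) ℂ, ∃ a : Fin N → ℂ, Function.Injective a ∧
      A = V * diagonal a * Vᴴ := by
  refine ⟨hA.eigenvectorUnitary, hA.eigenvectorUnitary.2,
    fun i => (hA.eigenvalues i : ℂ), ?_, ?_⟩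
  · have h : (Finset.univ.image fun i => (hA.eigenvalues i : ℂ)).card = N := by
      rw [hA.roots_charpoly_eq_eigenvalues] at hcard
      exact hcard
    have hinj := Finset.injOn_of_card_image_eq (h.trans (Finset.card_fin N).symm)
    exact fun i j hij => hinj (by simp) (by simp) hij
  · exact hA.spectral_theorem

theorem Matrix.eq_diagonal_of_commute_diagonal {n R : Type*} [Fintype n] [DecidableEq n]
    [CommRing R] [IsDomain R] {c : n → R} (hc : Function.Injective c) {Y : Matrix n n R}
    (h : Y * diagonal c = diagonal c * Y) : Y = diagonal Y.diag := by
  ext i j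
  by_cases hij : i = j
  · subst hij; simp
  · have hentry := congrFun (congrFun h i) j
    rw [mul_diagonal, diagonal_mul, mul_comm] at hentry
    rw [diagonal_apply_ne _ hij]
    have hne : c j - c i ≠ 0 := sub_ne_zero.mpr fun e => hij (hc e.symm)
    refine (mul_eq_zero.mp ?_).resolve_left hne
    rw [sub_mul, hentry, sub_self]

theorem Matrix.exists_unitary_diagonal_comp_perm {n : Type*} [Fintype n] [DecidableEq n]
    (a : n → ℂ) (σ : Equiv.Perm n) :
    ∃ P ∈ unitaryGroup n ℂ, diagonal (a ∘ σ) = P * diagonal a * Pᴴ := by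
  refine ⟨(1 : Matrix n n ℂ).submatrix σ id, ?_, ?_⟩
  · rw [mem_unitaryGroup_iff, star_eq_conjTranspose, conjTranspose_submatrix,
      conjTranspose_one, ← submatrix_mul _ _ _ _ _ Function.bijective_id, one_mul,
      submatrix_one_equiv]
  · have h : diagonal a = (diagonal a).submatrix id id := (submatrix_id_id _).symm
    rw [conjTranspose_submatrix, conjTranspose_one, h,
      ← submatrix_mul _ _ _ _ _ Function.bijective_id,
      ← submatrix_mul _ _ _ _ _ Function.bijective_id, one_mul, mul_one,
      submatrix_diagonal_equiv]

theorem Matrix.charpoly_unitary_conj {n : Type*} [Fintype n] [DecidableEq n]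
    {U : Matrix n n ℂ} (hU : U ∈ unitaryGroup n ℂ) (A : Matrix n n ℂ) :
    (U * A * Uᴴ).charpoly = A.charpoly := by
  have h : Uᴴ * U = 1 := mem_unitaryGroup_iff'.mp hU
  rw [charpoly_mul_comm, ← mul_assoc, h, one_mul]

theorem Matrix.roots_charpoly_diagonal {n : Type*} [Fintype n] [DecidableEq n] (a : n → ℂ) :
    (diagonal a).charpoly.roots = Finset.univ.val.map a := by
  rw [charpoly_diagonal]
  rw [Polynomial.roots_prod]
  · simp
  · simp [Finset.prod_ne_zero_iff, Polynomial.X_sub_C_ne_zero]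

/-- The matrices on the unitary orbit of `diagonal a` (conjugated by `W`) that commute with a
matrix with simple spectrum diagonalized by `V` are the rearrangements of `a` in the basis `V`. -/
theorem Matrix.setOf_commute_and_mem_orbit_eq_range {n : Type*} [Fintype n] [DecidableEq n]
    {V W : Matrix n n ℂ} (hV : V ∈ unitaryGroup n ℂ) (hW : W ∈ unitaryGroup n ℂ)
    {a c : n → ℂ} (ha : Function.Injective a) (hc : Function.Injective c) :
    {X : Matrix n n ℂ | X * (V * diagonal c * Vᴴ) = V * diagonal c * Vᴴ * X ∧
        ∃ U ∈ unitaryGroup n ℂ, X = U * (W * diagonal a * Wᴴ) * Uᴴ} =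
      Set.range fun σ : Equiv.Perm n => V * diagonal (a ∘ σ) * Vᴴ := by
  have hV1 : Vᴴ * V = 1 := mem_unitaryGroup_iff'.mp hV
  have hV2 : V * Vᴴ = 1 := mem_unitaryGroup_iff.mp hV
  have hW1 : Wᴴ * W = 1 := mem_unitaryGroup_iff'.mp hW
  have hVH : Vᴴ ∈ unitaryGroup n ℂ := Unitary.star_mem hV
  have hWH : Wᴴ ∈ unitaryGroup n ℂ := Unitary.star_mem hW
  ext X
  constructor
  · rintro ⟨hcomm, U, hU, hX⟩
    have hY : Vᴴ * X * V * diagonal c = diagonal c * (Vᴴ * X * V) := by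
      calc Vᴴ * X * V * diagonal c
          = Vᴴ * (X * (V * diagonal c * Vᴴ)) * V := by
            simp only [mul_assoc, hV1, mul_one]
        _ = Vᴴ * V * (diagonal c * (Vᴴ * X * V)) := by
            rw [hcomm]; simp only [mul_assoc]
        _ = diagonal c * (Vᴴ * X * V) := by rw [hV1, one_mul]
    have hdiag := eq_diagonal_of_commute_diagonal hc hY
    have hchar : (Vᴴ * X * V).charpoly = (diagonal a).charpoly := by
      have h := charpoly_unitary_conj hVH X
      rw [conjTranspose_conjTranspose] at h
      rw [h, hX, charpoly_unitary_conj hU, charpoly_unitary_conj hW]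
    have hroots := congrArg Polynomial.roots hchar
    rw [hdiag, roots_charpoly_diagonal, roots_charpoly_diagonal] at hroots
    obtain ⟨σ, hσ⟩ := ha.exists_perm_eq_comp_of_map_univ_eq hroots
    refine ⟨σ, ?_⟩
    change V * diagonal (a ∘ σ) * Vᴴ = X
    rw [← hσ, ← hdiag]
    calc V * (Vᴴ * X * V) * Vᴴ = V * Vᴴ * X * (V * Vᴴ) := by simp only [mul_assoc]
      _ = X := by rw [hV2, one_mul, mul_one]
  · rintro ⟨σ, rfl⟩
    refine ⟨?_, ?_⟩
    · have key (d e : n → ℂ) : V * diagonal d * Vᴴ * (V * diagonal e * Vᴴ) =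
          V * diagonal (fun i => d i * e i) * Vᴴ := by
        rw [← diagonal_mul_diagonal]
        calc V * diagonal d * Vᴴ * (V * diagonal e * Vᴴ)
            = V * diagonal d * (Vᴴ * V) * (diagonal e * Vᴴ) := by simp only [mul_assoc]
          _ = V * (diagonal d * diagonal e) * Vᴴ := by
            rw [hV1, mul_one]; simp only [mul_assoc]
      simp only [key, mul_comm]
    · obtain ⟨P, hP, hPa⟩ := exists_unitary_diagonal_comp_perm a σ
      refine ⟨V * P * Wᴴ, mul_mem (mul_mem hV hP) hWH, ?_⟩
      beta_reduce
      rw [hPa]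
      calc V * (P * diagonal a * Pᴴ) * Vᴴ
          = V * P * (Wᴴ * W) * diagonal a * (Wᴴ * W) * Pᴴ * Vᴴ := by
            rw [hW1, mul_one, mul_one]; simp only [mul_assoc]
        _ = V * P * Wᴴ * (W * diagonal a * Wᴴ) * (V * P * Wᴴ)ᴴ := by
            simp only [conjTranspose_mul, conjTranspose_conjTranspose, mul_assoc]

theorem Matrix.injective_conj_diagonal_comp_perm {n : Type*} [Fintype n] [DecidableEq n]
    {V : Matrix n n ℂ} (hV : V ∈ unitaryGroup n ℂ) {a : n → ℂ} (ha : Function.Injective a) :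
    Function.Injective fun σ : Equiv.Perm n => V * diagonal (a ∘ σ) * Vᴴ := by
  have hV1 : Vᴴ * V = 1 := mem_unitaryGroup_iff'.mp hV
  have cancel (D : Matrix n n ℂ) : Vᴴ * (V * D * Vᴴ) * V = D := by
    calc Vᴴ * (V * D * Vᴴ) * V = Vᴴ * V * D * (Vᴴ * V) := by simp only [mul_assoc]
      _ = D := by rw [hV1, one_mul, mul_one]
  intro σ τ h
  have h' := congrArg (fun X => Vᴴ * X * V) h
  simp only [cancel] at h'
  ext1 i
  exact ha (congrFun (diagonal_injective h') i)


/-- For Hermitian `N×N` complex matrices `A` and `C`, each with `N` distinct eigenvalues,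
the set of matrices on the unitary orbit of `A` that commute with `C` — i.e. the set of
equilibria of the double-bracket flow `Ẋ = [X,[X,C]]` on the unitary orbit of `A` — is
finite and has exactly `N!` elements. -/
theorem stmt7 (N : ℕ) (hN : 1 ≤ N) (A C : Matrix (Fin N) (Fin N) ℂ)
    (hA : Aᴴ = A) (hC : Cᴴ = C)
    (hAev : A.charpoly.roots.toFinset.card = N)
    (hCev : C.charpoly.roots.toFinset.card = N) :
    {X : Matrix (Fin N) (Fin N) ℂ | X * C = C * X ∧
        ∃ U ∈ Matrix.unitaryGroup (Fin N) ℂ, X = U * A * Uᴴ}.Finite ∧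
    {X : Matrix (Fin N) (Fin N) ℂ | X * C = C * X ∧
        ∃ U ∈ Matrix.unitaryGroup (Fin N) ℂ, X = U * A * Uᴴ}.ncard = N.factorial := by
  obtain ⟨W, hW, a, ha, rfl⟩ := Matrix.exists_unitary_diagonal_of_card_roots hA hAev
  obtain ⟨V, hV, c, hc, rfl⟩ := Matrix.exists_unitary_diagonal_of_card_roots hC hCev
  rw [Matrix.setOf_commute_and_mem_orbit_eq_range hV hW ha hc]
  refine ⟨Set.finite_range _, ?_⟩
  rw [← Set.image_univ,
    Set.ncard_image_of_injective _ (Matrix.injective_conj_diagonal_comp_perm hV ha),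
    Set.ncard_univ, Nat.card_perm, Nat.card_fin]
end

section
/- Let E be a finite-dimensional real inner product space and let f : E → ℝ be a smooth function all of whose superlevel sets {x ∈ E : f(x) ≥ c}, c ∈ ℝ, are compact. Then every maximal solution of the gradient flow ẋ = ∇f(x) exists for all t ≥ 0, and for each such solution x the ω-limit set ω(x) := ⋂_{T ≥ 0} closure{x(t) : t ≥ T} is a nonempty, compact and connected subset of the set {p ∈ E : ∇f(p) = 0} of critical points of f. -/
open Filter Topology

section

open Set

open scoped NNReal

theorem isCompact_iInter_of_isCompact {X ι : Type*} [TopologicalSpace X] [T2Space X]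
    [Nonempty ι] {V : ι → Set X} (hcpt : ∀ i, IsCompact (V i)) : IsCompact (⋂ i, V i) :=
  (hcpt (Classical.arbitrary ι)).of_isClosed_subset
    (isClosed_iInter fun i ↦ (hcpt i).isClosed) (iInter_subset V _)

theorem isPreconnected_iInter_of_directed {X ι : Type*} [TopologicalSpace X] [T2Space X]
    [Nonempty ι] {V : ι → Set X} (hV : Directed (· ⊇ ·) V) (hcpt : ∀ i, IsCompact (V i))
    (hconn : ∀ i, IsPreconnected (V i)) : IsPreconnected (⋂ i, V i) := by
  have hS : IsCompact (⋂ i, V i) := isCompact_iInter_of_isCompact hcpt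
  rw [isPreconnected_iff_subset_of_fully_disjoint_closed hS.isClosed]
  intro u v hu hv huv hdisj
  obtain ⟨U, W, hU, hW, huU, hvW, hUW⟩ :=
    SeparatedNhds.of_isCompact_isCompact (hS.inter_right hu) (hS.inter_right hv)
      (hdisj.mono inter_subset_right inter_subset_right)
  have hSUW : ⋂ i, V i ⊆ U ∪ W := fun p hp ↦
    (huv hp).imp (fun h ↦ huU ⟨hp, h⟩) (fun h ↦ hvW ⟨hp, h⟩)
  obtain ⟨i, hi⟩ := exists_subset_nhds_of_isCompact' hV hcpt (fun i ↦ (hcpt i).isClosed)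
    (fun p hp ↦ (hU.union hW).mem_nhds (hSUW hp))
  rcases isPreconnected_iff_subset_of_disjoint.1 (hconn i) U W hU hW hi
    (by rw [hUW.inter_eq, inter_empty]) with h | h
  · refine Or.inl fun p hp ↦ (huv hp).resolve_right fun hpv ↦ ?_
    exact disjoint_left.1 hUW (h (mem_iInter.1 hp i)) (hvW ⟨hp, hpv⟩)
  · refine Or.inr fun p hp ↦ (huv hp).resolve_left fun hpu ↦ ?_
    exact disjoint_left.1 hUW (huU ⟨hp, hpu⟩) (h (mem_iInter.1 hp i))

theorem exists_integralCurve_of_lipschitz_of_bounded {E : Type*} [NormedAddCommGroup E]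
    [NormedSpace ℝ E] [CompleteSpace E] {v : E → E} (hv : ContDiff ℝ 1 v) {K L : ℝ≥0}
    (hK : LipschitzWith K v) (hL : ∀ x, ‖v x‖ ≤ L) (x₀ : E) :
    ∃ γ : ℝ → E, γ 0 = x₀ ∧ ∀ t, HasDerivAt γ (v (γ t)) t := by
  have hlocal (x : E) : ∃ γ : ℝ → E, γ 0 = x ∧
      IsMIntegralCurveOn (I := modelWithCornersSelf ℝ E) γ v (Ioo (-1) 1) := by
    have hpl : IsPicardLindelof (fun _ ↦ v)
        (⟨0, by norm_num, by norm_num⟩ : Icc (-1 : ℝ) 1) x L 0 L K :=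
      .of_time_independent (fun y _ ↦ hL y) hK.lipschitzOnWith (by norm_num)
    obtain ⟨γ, hγ, hd⟩ := hpl.exists_eq_forall_mem_Icc_hasDerivWithinAt₀
    refine ⟨γ, hγ, fun t ht ↦ ?_⟩
    exact ((hd t (Ioo_subset_Icc_self ht)).mono Ioo_subset_Icc_self).hasFDerivWithinAt
      |>.hasMFDerivWithinAt
  obtain ⟨γ, hγ, hd⟩ := exists_isMIntegralCurve_of_isMIntegralCurveOn
    (I := modelWithCornersSelf ℝ E) (v := v)
    (contMDiff_vectorSpace_iff_contDiff.2 hv) one_pos hlocal x₀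
  exact ⟨γ, hγ, fun t ↦ hasDerivAt_iff_hasFDerivAt.2 (hd t).hasFDerivAt⟩

variable {E : Type*} [NormedAddCommGroup E] [InnerProductSpace ℝ E] [FiniteDimensional ℝ E]
  {f : E → ℝ}

theorem contDiff_gradient {n : WithTop ℕ∞} (hf : ContDiff ℝ (n + 1) f) :
    ContDiff ℝ n (gradient f) :=
  (InnerProductSpace.toDual ℝ E).symm.toContinuousLinearEquiv.contDiff.comp
    (hf.fderiv_right le_rfl)

theorem hasDerivAt_comp_smul_gradient (hf : Differentiable ℝ f) {x : ℝ → E} {t c : ℝ}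
    (hx : HasDerivAt x (c • gradient f (x t)) t) :
    HasDerivAt (fun s ↦ f (x s)) (c * ‖gradient f (x t)‖ ^ 2) t := by
  have h := (hf (x t)).hasFDerivAt.comp_hasDerivAt t hx
  rwa [map_smul, ← inner_gradient_left, real_inner_self_eq_norm_sq, smul_eq_mul] at h

theorem hasDerivAt_comp_gradient (hf : Differentiable ℝ f) {x : ℝ → E} {t : ℝ}
    (hx : HasDerivAt x (gradient f (x t)) t) :
    HasDerivAt (fun s ↦ f (x s)) (‖gradient f (x t)‖ ^ 2) t := by
  rw [← one_smul ℝ (gradient f (x t))] at hx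
  simpa using hasDerivAt_comp_smul_gradient hf hx

theorem exists_gradient_flow (hf : ContDiff ℝ 2 f)
    (hcpt : ∀ c : ℝ, IsCompact {x : E | c ≤ f x}) (x₀ : E) :
    ∃ x : ℝ → E, x 0 = x₀ ∧ ∀ t : ℝ, 0 ≤ t → HasDerivAt x (gradient f (x t)) t := by
  obtain ⟨R, hR, hKR⟩ := (hcpt (f x₀)).isBounded.subset_closedBall_lt 0 x₀
  let χ : ContDiffBump x₀ := ⟨R, R + 1, hR, lt_add_one R⟩
  have hv : ContDiff ℝ 1 (fun y ↦ χ y • gradient f y) :=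
    χ.contDiff.smul (contDiff_gradient (by simpa [one_add_one_eq_two] using hf))
  have hsupp : HasCompactSupport (fun y ↦ χ y • gradient f y) := χ.hasCompactSupport.smul_right
  obtain ⟨K, hK⟩ := hv.lipschitzWith_of_hasCompactSupport hsupp one_ne_zero
  obtain ⟨L, hL⟩ := hv.continuous.bounded_above_of_compact_support hsupp
  obtain ⟨γ, hγ, hd⟩ := exists_integralCurve_of_lipschitz_of_bounded hv hK
    (L := L.toNNReal) (fun y ↦ (hL y).trans (Real.le_coe_toNNReal L)) x₀
  have hfd := fun t ↦ hasDerivAt_comp_smul_gradient (hf.differentiable two_ne_zero) (hd t)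
  have hmono : Monotone fun s ↦ f (γ s) :=
    monotone_of_deriv_nonneg (fun t ↦ (hfd t).differentiableAt) fun t ↦ by
      rw [(hfd t).deriv]
      exact mul_nonneg χ.nonneg (sq_nonneg _)
  refine ⟨γ, hγ, fun t ht ↦ ?_⟩
  have hmem : f x₀ ≤ f (γ t) := hγ ▸ hmono ht
  simpa [χ.one_of_mem_closedBall (hKR hmem)] using hd t

variable {x : ℝ → E}

theorem monotoneOn_comp_gradient_flow (hf : Differentiable ℝ f)
    (hx : ∀ t : ℝ, 0 ≤ t → HasDerivAt x (gradient f (x t)) t) :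
    MonotoneOn (fun s ↦ f (x s)) (Ici 0) := by
  have hfd := fun t ht ↦ hasDerivAt_comp_gradient hf (hx t ht)
  refine monotoneOn_of_deriv_nonneg (convex_Ici 0)
    (fun t ht ↦ (hfd t ht).continuousAt.continuousWithinAt) (fun t ht ↦ ?_) (fun t ht ↦ ?_)
  · exact (hfd t (interior_subset ht)).differentiableAt.differentiableWithinAt
  · rw [(hfd t (interior_subset ht)).deriv]
    positivity

theorem gradient_eq_zero_of_mem_omegaLimit (hf : ContDiff ℝ 1 f) {K : Set E} (hK : IsCompact K)
    (hx : ∀ t : ℝ, 0 ≤ t → HasDerivAt x (gradient f (x t)) t) (hxK : ∀ t, 0 ≤ t → x t ∈ K)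
    {p : E} (hp : ∀ T : ℝ, 0 ≤ T → p ∈ closure (x '' Ici T)) : gradient f p = 0 := by
  by_contra hne
  have hdf : Differentiable ℝ f := hf.differentiable one_ne_zero
  have hgc : Continuous (gradient f) := (contDiff_gradient (n := 0) (by simpa using hf)).continuous
  have hmono := monotoneOn_comp_gradient_flow hdf hx
  have hfd := fun t ht ↦ hasDerivAt_comp_gradient hdf (hx t ht)
  have hgp : 0 < ‖gradient f p‖ ^ 2 := by positivity
  obtain ⟨δ, hδ, hδp⟩ := exists_between hgp
  obtain ⟨r, hr, hball⟩ := Metric.eventually_nhds_iff_ball.1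
    ((hgc.norm.pow 2).continuousAt.eventually (lt_mem_nhds hδp))
  obtain ⟨M, hM⟩ := hK.exists_bound_of_continuousOn hgc.continuousOn
  obtain ⟨B, hB⟩ := hK.exists_bound_of_continuousOn hdf.continuous.continuousOn
  have hM0 : 0 ≤ M := (norm_nonneg _).trans (hM _ (hxK 0 le_rfl))
  obtain ⟨τ, hτ, hτM⟩ : ∃ τ, 0 < τ ∧ M * τ < r / 2 := by
    refine ⟨r / (2 * (M + 1)), by positivity, ?_⟩
    rw [← mul_div_assoc, div_lt_div_iff₀ (by positivity) two_pos]
    nlinarith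
  have hgain : ∀ T, 0 ≤ T → ∃ t, T ≤ t ∧ f (x T) + δ * τ ≤ f (x t) := by
    intro T hT
    obtain ⟨_, ⟨t, ht, rfl⟩, hpt⟩ := Metric.mem_closure_iff.1 (hp T hT) (r / 2) (half_pos hr)
    have ht0 : 0 ≤ t := hT.trans ht
    have hnear : ∀ s ∈ Icc t (t + τ), x s ∈ Metric.ball p r := fun s hs ↦ by
      have h := (convex_Icc t (t + τ)).norm_image_sub_le_of_norm_hasDerivWithin_le
        (fun u hu ↦ (hx u (ht0.trans hu.1)).hasDerivWithinAt)
        (fun u hu ↦ hM _ (hxK u (ht0.trans hu.1))) (left_mem_Icc.2 (by linarith)) hs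
      rw [← dist_eq_norm, Real.norm_of_nonneg (by linarith [hs.1])] at h
      have h' : M * (s - t) ≤ M * τ := by gcongr; linarith [hs.2]
      rw [Metric.mem_ball]
      linarith [dist_triangle (x s) (x t) p, dist_comm p (x t)]
    have h := (convex_Icc t (t + τ)).mul_sub_le_image_sub_of_le_deriv
      (fun u hu ↦ (hfd u (ht0.trans hu.1)).continuousAt.continuousWithinAt)
      (fun u hu ↦ (hfd u (ht0.trans (interior_subset hu).1)).differentiableAt
        |>.differentiableWithinAt)
      (C := δ) (fun u hu ↦ by
        rw [(hfd u (ht0.trans (interior_subset hu).1)).deriv]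
        exact (hball _ (hnear u (interior_subset hu))).le)
      t (left_mem_Icc.2 (by linarith)) (t + τ) (right_mem_Icc.2 (by linarith)) (by linarith)
    have hTt : f (x T) ≤ f (x t) := hmono hT ht0 ht
    have ht' : T ≤ t := ht
    refine ⟨t + τ, by linarith, ?_⟩
    simp only [add_sub_cancel_left] at h
    linarith
  have hiter : ∀ n : ℕ, ∃ t, 0 ≤ t ∧ f (x 0) + n * (δ * τ) ≤ f (x t) := by
    intro n
    induction n with
    | zero => exact ⟨0, le_rfl, by simp⟩
    | succ n ih =>
      obtain ⟨t, ht, h⟩ := ih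
      obtain ⟨s, hs, h'⟩ := hgain t ht
      refine ⟨s, ht.trans hs, ?_⟩
      push_cast
      linarith
  obtain ⟨n, hn⟩ := exists_nat_gt ((B - f (x 0)) / (δ * τ))
  rw [div_lt_iff₀ (by positivity)] at hn
  obtain ⟨t, ht, h⟩ := hiter n
  linarith [(le_abs_self _).trans (hB _ (hxK t ht))]

end

/-- For a smooth function `f` on a finite-dimensional real inner product space whose
superlevel sets are all compact: solutions of the gradient flow `ẋ = ∇f(x)` exist on
`[0,∞)` from every initial condition, and for every solution defined for all `t ≥ 0` the
ω-limit set `⋂_{T} closure {x(t) : t ≥ T}` is a nonempty, compact, connected subset of the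
set of critical points of `f`. -/
theorem stmt12 (E : Type*) [NormedAddCommGroup E] [InnerProductSpace ℝ E]
    [FiniteDimensional ℝ E]
    (f : E → ℝ) (hf : ContDiff ℝ (⊤ : ℕ∞) f)
    (hcpt : ∀ c : ℝ, IsCompact {x : E | c ≤ f x}) :
    (∀ x₀ : E, ∃ x : ℝ → E, x 0 = x₀ ∧
      ∀ t : ℝ, 0 ≤ t → HasDerivAt x (gradient f (x t)) t) ∧
    ∀ x : ℝ → E, (∀ t : ℝ, 0 ≤ t → HasDerivAt x (gradient f (x t)) t) →
      (⋂ T : ℝ, closure (x '' Set.Ici T)).Nonempty ∧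
      IsCompact (⋂ T : ℝ, closure (x '' Set.Ici T)) ∧
      IsConnected (⋂ T : ℝ, closure (x '' Set.Ici T)) ∧
      (⋂ T : ℝ, closure (x '' Set.Ici T)) ⊆ {p : E | gradient f p = 0} := by
  refine ⟨exists_gradient_flow (contDiff_infty.1 hf 2) hcpt, fun x hx ↦ ?_⟩
  have hf1 : ContDiff ℝ 1 f := contDiff_infty.1 hf 1
  have hmono := monotoneOn_comp_gradient_flow (hf1.differentiable one_ne_zero) hx
  have hK := hcpt (f (x 0))
  have hxK : ∀ t, 0 ≤ t → x t ∈ {y : E | f (x 0) ≤ f y} := fun t ht ↦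
    hmono Set.self_mem_Ici ht ht
  let V : NNReal → Set E := fun T ↦ closure (x '' Set.Ici (T : ℝ))
  have hanti : Antitone V := fun S T h ↦
    closure_mono (Set.image_mono (Set.Ici_subset_Ici.2 (NNReal.coe_le_coe.2 h)))
  have hV : ⋂ T : ℝ, closure (x '' Set.Ici T) = ⋂ T, V T := by
    refine Set.Subset.antisymm (Set.subset_iInter fun T ↦ Set.iInter_subset _ (T : ℝ))
      (Set.subset_iInter fun T ↦ (Set.iInter_subset V T.toNNReal).trans ?_)
    exact closure_mono (Set.image_mono (Set.Ici_subset_Ici.2 (Real.le_coe_toNNReal T)))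
  have hVcpt : ∀ T, IsCompact (V T) := fun T ↦
    hK.of_isClosed_subset isClosed_closure <| closure_minimal
      (Set.image_subset_iff.2 fun t ht ↦ hxK t (T.coe_nonneg.trans ht)) hK.isClosed
  have hVconn : ∀ T, IsConnected (V T) := fun T ↦
    (isConnected_Ici.image x fun t ht ↦
      (hx t (T.coe_nonneg.trans ht)).continuousAt.continuousWithinAt).closure
  rw [hV]
  have hne : (⋂ T, V T).Nonempty :=
    IsCompact.nonempty_iInter_of_directed_nonempty_isCompact_isClosed V hanti.directed_ge
      (fun T ↦ (hVconn T).nonempty) hVcpt fun T ↦ (hVcpt T).isClosed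
  refine ⟨hne, isCompact_iInter_of_isCompact hVcpt, ⟨hne, isPreconnected_iInter_of_directed
    hanti.directed_ge hVcpt fun T ↦ (hVconn T).isPreconnected⟩, fun p hp ↦ ?_⟩
  exact gradient_eq_zero_of_mem_omegaLimit hf1 hK hx hxK fun T hT ↦ Set.mem_iInter.1 hp ⟨T, hT⟩
end

section
/- Let E be a finite-dimensional real inner product space and let f : E → ℝ be a smooth function all of whose superlevel sets {x ∈ E : f(x) ≥ c}, c ∈ ℝ, are compact, and assume that every critical point of f is isolated in the set of critical points. Then every solution of the gradient flow ẋ = ∇f(x) defined on [0,∞) converges, as t → +∞, to a critical point of f. -/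
open Filter Topology

/-- A continuous curve in a proper metric space that has `p` as a cluster point at infinity, and no
other cluster point near `p`, converges to `p`. -/
theorem tendsto_of_mapClusterPt_of_isolated {X : Type*} [MetricSpace X] [ProperSpace X]
    {x : ℝ → X} {a : ℝ} (hx : ContinuousOn x (Set.Ici a)) {p : X} (hp : MapClusterPt p atTop x)
    {U : Set X} (hU : U ∈ 𝓝 p) (hiso : ∀ q ∈ U, MapClusterPt q atTop x → q = p) :
    Tendsto x atTop (𝓝 p) := by
  obtain ⟨r, hr, hrU⟩ := Metric.nhds_basis_closedBall.mem_iff.1 hU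
  rw [Metric.tendsto_nhds]
  intro ε hε
  by_contra hcon
  set δ := min ε r
  have hδ : 0 < δ := lt_min hε hr
  have hsphere : ∃ᶠ t in atTop, x t ∈ Metric.sphere p δ := by
    rw [frequently_atTop]
    intro b
    have hin : ∃ᶠ t in atTop, x t ∈ Metric.ball p δ := hp.frequently (Metric.ball_mem_nhds p hδ)
    obtain ⟨s, hs, hsp⟩ := frequently_atTop.1 hin (max a b)
    obtain ⟨t, ht, htp⟩ := frequently_atTop.1 (not_eventually.1 hcon) s
    have hcont : ContinuousOn (fun u => dist (x u) p) (Set.Icc s t) :=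
      (continuous_id.dist continuous_const).comp_continuousOn
        (hx.mono fun u hu => ((le_max_left a b).trans hs).trans hu.1)
    obtain ⟨u, hu, hup⟩ := intermediate_value_Icc ht hcont
      ⟨(Metric.mem_ball.1 hsp).le, (min_le_left ε r).trans (not_lt.1 htp)⟩
    exact ⟨u, ((le_max_right a b).trans hs).trans hu.1, hup⟩
  obtain ⟨q, hq, hqx⟩ := (isCompact_sphere p δ).exists_mapClusterPt_of_frequently hsphere
  have hqp : q = p := hiso q
    (hrU (Metric.mem_closedBall.2 ((Metric.mem_sphere.1 hq).le.trans (min_le_right ε r)))) hqx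
  rw [hqp, Metric.mem_sphere, dist_self] at hq
  exact hδ.ne hq

section GradientFlow

variable {E : Type*} [NormedAddCommGroup E] [InnerProductSpace ℝ E] [CompleteSpace E]
  {f : E → ℝ} {x : ℝ → E}

theorem ContDiff.continuous_gradient {n : WithTop ℕ∞} (hf : ContDiff ℝ n f) (hn : n ≠ 0) :
    Continuous (gradient f) :=
  (InnerProductSpace.toDual ℝ E).symm.continuous.comp (hf.continuous_fderiv hn)

theorem hasDerivAt_comp_of_gradient_flow {t : ℝ} (hf : DifferentiableAt ℝ f (x t))
    (hx : HasDerivAt x (gradient f (x t)) t) :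
    HasDerivAt (fun s => f (x s)) (‖gradient f (x t)‖ ^ 2) t := by
  have h := hf.hasGradientAt.hasFDerivAt.comp_hasDerivAt t hx
  rwa [InnerProductSpace.toDual_apply_apply, real_inner_self_eq_norm_sq] at h

/-- If the values of `f` converge along a gradient flow line of bounded speed, then every cluster
point of that line is critical. -/
theorem gradient_eq_zero_of_mapClusterPt (hf : Differentiable ℝ f)
    (hcont : Continuous (gradient f))
    (hx : ∀ t : ℝ, 0 ≤ t → HasDerivAt x (gradient f (x t)) t) {M : ℝ}
    (hM : ∀ t : ℝ, 0 ≤ t → ‖gradient f (x t)‖ ≤ M) {L : ℝ}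
    (hL : Tendsto (fun t => f (x t)) atTop (𝓝 L)) {p : E} (hp : MapClusterPt p atTop x) :
    gradient f p = 0 := by
  by_contra hne
  obtain ⟨c, hc, hcp⟩ : ∃ c, 0 < c ∧ c < ‖gradient f p‖ ^ 2 := exists_between (by positivity)
  obtain ⟨r, hr, hball⟩ := Metric.mem_nhds_iff.1
    (((hcont.norm.pow 2).tendsto p).eventually (lt_mem_nhds hcp))
  have hM0 : 0 ≤ M := (norm_nonneg _).trans (hM 0 le_rfl)
  set δ := r / 2 / (M + 1) with hδ_def
  have hδ : 0 < δ := by positivity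
  have hMδ : M * δ < r / 2 := by
    have : (M + 1) * δ = r / 2 := by rw [hδ_def]; field_simp
    nlinarith
  have hinc : Tendsto (fun t => f (x (t + δ)) - f (x t)) atTop (𝓝 0) := by
    simpa using (hL.comp (tendsto_atTop_add_const_right _ δ tendsto_id)).sub hL
  obtain ⟨t, hpt, hlt, ht⟩ :=
    ((hp.frequently (Metric.ball_mem_nhds p (half_pos hr))).and_eventually
      ((hinc.eventually (gt_mem_nhds (mul_pos hc hδ))).and (eventually_ge_atTop 0))).exists
  have hmem : ∀ s ∈ Set.Icc t (t + δ), c < ‖gradient f (x s)‖ ^ 2 := by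
    intro s hs
    have h := (convex_Icc t (t + δ)).norm_image_sub_le_of_norm_hasDerivWithin_le
      (fun u hu => (hx u (ht.trans hu.1)).hasDerivWithinAt) (fun u hu => hM u (ht.trans hu.1))
      (Set.left_mem_Icc.2 (by linarith)) hs
    rw [Real.norm_of_nonneg (sub_nonneg.2 hs.1), ← dist_eq_norm] at h
    have h' : M * (s - t) ≤ M * δ := mul_le_mul_of_nonneg_left (by linarith [hs.2]) hM0
    refine hball (Metric.mem_ball.2 ?_)
    linarith [dist_triangle (x s) (x t) p, Metric.mem_ball.1 hpt]
  have hd : ∀ s ∈ Set.Icc t (t + δ),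
      HasDerivAt (fun u => f (x u)) (‖gradient f (x s)‖ ^ 2) s := fun s hs =>
    hasDerivAt_comp_of_gradient_flow (hf _) (hx s (ht.trans hs.1))
  have hgrow := (convex_Icc t (t + δ)).mul_sub_le_image_sub_of_le_deriv
    (fun s hs => (hd s hs).continuousAt.continuousWithinAt)
    (fun s hs => (hd s (interior_subset hs)).differentiableAt.differentiableWithinAt)
    (fun s hs => (hmem s (interior_subset hs)).le.trans_eq (hd s (interior_subset hs)).deriv.symm)
    t (Set.left_mem_Icc.2 (by linarith)) (t + δ) (Set.right_mem_Icc.2 (by linarith))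
    (by linarith)
  rw [add_sub_cancel_left] at hgrow
  exact hlt.not_ge hgrow

theorem monotoneOn_of_gradient_flow (hf : Differentiable ℝ f)
    (hx : ∀ t : ℝ, 0 ≤ t → HasDerivAt x (gradient f (x t)) t) :
    MonotoneOn (fun t => f (x t)) (Set.Ici 0) := by
  have hd : ∀ t ∈ Set.Ici (0 : ℝ), HasDerivAt (fun s => f (x s)) (‖gradient f (x t)‖ ^ 2) t :=
    fun t ht => hasDerivAt_comp_of_gradient_flow (hf _) (hx t ht)
  exact monotoneOn_of_hasDerivWithinAt_nonneg (convex_Ici 0)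
    (fun t ht => (hd t ht).continuousAt.continuousWithinAt)
    (fun t ht => (hd t (interior_subset ht)).hasDerivWithinAt) (fun t _ => sq_nonneg _)

end GradientFlow

/-- For a smooth function `f` on a finite-dimensional real inner product space with compact
superlevel sets and isolated critical points, every solution of the gradient flow
`ẋ = ∇f(x)` defined for all `t ≥ 0` converges, as `t → ∞`, to a critical point of `f`. -/
theorem stmt13 (E : Type*) [NormedAddCommGroup E] [InnerProductSpace ℝ E]
    [FiniteDimensional ℝ E]
    (f : E → ℝ) (hf : ContDiff ℝ (⊤ : ℕ∞) f)
    (hcpt : ∀ c : ℝ, IsCompact {x : E | c ≤ f x})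
    (hiso : ∀ p : E, gradient f p = 0 →
      ∃ U ∈ 𝓝 p, ∀ q ∈ U, gradient f q = 0 → q = p) :
    ∀ x : ℝ → E, (∀ t : ℝ, 0 ≤ t → HasDerivAt x (gradient f (x t)) t) →
      ∃ p : E, gradient f p = 0 ∧ Tendsto x atTop (𝓝 p) := by
  intro x hx
  have hdiff : Differentiable ℝ f := hf.differentiable (by simp)
  have hgrad : Continuous (gradient f) := hf.continuous_gradient (by simp)
  have hmono := monotoneOn_of_gradient_flow hdiff hx
  have hK := hcpt (f (x 0))
  have hxK : ∀ t : ℝ, 0 ≤ t → x t ∈ {y : E | f (x 0) ≤ f y} := fun t ht =>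
    hmono Set.self_mem_Ici ht ht
  obtain ⟨M, hM⟩ := hK.exists_bound_of_continuousOn hgrad.continuousOn
  obtain ⟨B, hB⟩ := hK.bddAbove_image hf.continuous.continuousOn
  obtain ⟨L, hL⟩ : ∃ L, Tendsto (fun t => f (x t)) atTop (𝓝 L) := by
    have hmono' : Monotone fun t : ℝ => f (x (max t 0)) := fun s t hst =>
      hmono (le_max_right s 0) (le_max_right t 0) (max_le_max_right 0 hst)
    have hbdd : BddAbove (Set.range fun t : ℝ => f (x (max t 0))) :=
      ⟨B, Set.forall_mem_range.2 fun t => hB ⟨_, hxK _ (le_max_right t 0), rfl⟩⟩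
    refine ⟨_, (tendsto_atTop_ciSup hmono' hbdd).congr' ?_⟩
    filter_upwards [eventually_ge_atTop 0] with t ht
    rw [max_eq_left ht]
  have hcrit : ∀ q, MapClusterPt q atTop x → gradient f q = 0 := fun q hq =>
    gradient_eq_zero_of_mapClusterPt hdiff hgrad hx (fun t ht => hM _ (hxK t ht)) hL hq
  obtain ⟨p, -, hp⟩ := hK.exists_mapClusterPt_of_frequently
    ((eventually_ge_atTop (0 : ℝ)).mono hxK).frequently
  obtain ⟨U, hU, hUp⟩ := hiso p (hcrit p hp)
  exact ⟨p, hcrit p hp, tendsto_of_mapClusterPt_of_isolated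
    (fun t ht => (hx t ht).continuousAt.continuousWithinAt) hp hU
    fun q hq hqx => hUp q hq (hcrit q hqx)⟩
end

section
/- (Łojasiewicz convergence theorem for analytic gradient flows.) Let E be a finite-dimensional real inner product space and let f : E → ℝ be real analytic. Let x : [0,∞) → E be a solution of the gradient flow ẋ = ∇f(x) whose ω-limit set ω(x) is nonempty. Then ω(x) is a singleton: x(t) converges as t → +∞ to a single critical point x* of f. -/
open Filter Topology

namespace AnalyticGerm

section General

variable {E : Type*} [NormedAddCommGroup E] [NormedSpace ℝ E]

theorem eventually_eq_zero_or_of_mul {a b : E → ℝ} {p : E} (ha : AnalyticAt ℝ a p)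
    (hb : AnalyticAt ℝ b p) (h : ∀ᶠ x in 𝓝 p, a x * b x = 0) :
    (∀ᶠ x in 𝓝 p, a x = 0) ∨ ∀ᶠ x in 𝓝 p, b x = 0 := by
  by_contra! hne
  obtain ⟨hna, hnb⟩ := hne
  obtain ⟨r, hr, hball⟩ := Metric.eventually_nhds_iff_ball.1
    (ha.eventually_analyticAt.and (hb.eventually_analyticAt.and h))
  obtain ⟨x, hxa, hx⟩ := (hna.and_eventually (Metric.ball_mem_nhds p hr)).exists
  have hbx : b =ᶠ[𝓝 x] 0 := by
    filter_upwards [(hball x hx).1.continuousAt.eventually_ne hxa,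
      Metric.isOpen_ball.mem_nhds hx] with y hy hyb
    exact (mul_eq_zero.1 (hball y hyb).2.2).resolve_left hy
  have hb0 : Set.EqOn b 0 (Metric.ball p r) :=
    AnalyticOnNhd.eqOn_zero_of_preconnected_of_eventuallyEq_zero
      (fun y hy => (hball y hy).2.1) (convex_ball p r).isPreconnected hx hbx
  exact hnb (by filter_upwards [Metric.ball_mem_nhds p hr] with y hy
    using not_not.2 (hb0 hy))

theorem eventuallyEq_of_mul_left {a b c : E → ℝ} {p : E} (ha : AnalyticAt ℝ a p)
    (hb : AnalyticAt ℝ b p) (hc : AnalyticAt ℝ c p) (hne : ¬ ∀ᶠ x in 𝓝 p, a x = 0)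
    (h : ∀ᶠ x in 𝓝 p, a x * b x = a x * c x) : ∀ᶠ x in 𝓝 p, b x = c x := by
  have := (eventually_eq_zero_or_of_mul ha (hb.sub hc)
    (h.mono fun x hx => by simp [mul_sub, hx])).resolve_left hne
  exact this.mono fun x hx => sub_eq_zero.1 hx

theorem not_eventually_prod_eq_zero {κ : Type*} (s : Finset κ) {f : κ → E → ℝ} {p : E}
    (hf : ∀ k ∈ s, AnalyticAt ℝ (f k) p) (hne : ∀ k ∈ s, ¬ ∀ᶠ x in 𝓝 p, f k x = 0) :
    ¬ ∀ᶠ x in 𝓝 p, ∏ k ∈ s, f k x = 0 := by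
  classical
  induction s using Finset.induction_on with
  | empty => simpa using (inferInstance : (𝓝 p).NeBot).ne
  | insert k s hk ih =>
    intro h
    simp only [Finset.prod_insert hk] at h
    rcases eventually_eq_zero_or_of_mul (hf k (by simp))
      (Finset.analyticAt_fun_prod s fun i hi => hf i (by simp [hi])) h with h | h
    · exact hne k (by simp) h
    · exact ih (fun i hi => hf i (by simp [hi])) (fun i hi => hne i (by simp [hi])) h

/-- The `n`-th coefficient of the quotient of `f x - f (P x)` by the linear form `ℓ`, where `p` is
the power series of `f` at the origin and `x - P x = ℓ x • v`. -/
noncomputable def quotientSeries (p : FormalMultilinearSeries ℝ E ℝ) (P : E →L[ℝ] E) (v : E) :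
    FormalMultilinearSeries ℝ E ℝ := fun n =>
  ∑ k : Fin (n + 1), ((p (n + 1)).curryMid k v).compContinuousLinearMap
    fun i => if k.succAbove i < k then ContinuousLinearMap.id ℝ E else P

theorem quotientSeries_apply (p : FormalMultilinearSeries ℝ E ℝ) (P : E →L[ℝ] E) (v : E)
    {x : E} {c : ℝ} (hx : x - P x = c • v) (n : ℕ) :
    c * quotientSeries p P v n (fun _ => x) =
      p (n + 1) (fun _ => x) - p (n + 1) (fun _ => P x) := by
  let w : ℕ → Fin (n + 1) → E := fun k i => if (i : ℕ) < k then x else P x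
  have key : ∀ k : Fin (n + 1), c * ((p (n + 1)).curryMid k v).compContinuousLinearMap
      (fun i => if k.succAbove i < k then ContinuousLinearMap.id ℝ E else P) (fun _ => x)
      = p (n + 1) (w (k + 1)) - p (n + 1) (w k) := by
    intro k
    have h1 : w (k + 1) = Function.update (w k) k x := by
      ext i
      by_cases hi : i = k
      · subst hi; simp [w]
      · have : (i : ℕ) ≠ k := fun h => hi (Fin.ext h)
        simp only [w, Function.update_of_ne hi]
        congr 1
        simp only [eq_iff_iff]
        omega
    have h2 : w k = Function.update (w k) k (P x) := by
      simp [w]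
    have h3 : (k.insertNth v fun i => (if k.succAbove i < k then ContinuousLinearMap.id ℝ E else P) x)
        = Function.update (w k) k v := by
      ext i
      refine Fin.succAboveCases k ?_ (fun j => ?_) i
      · simp
      · simp only [Fin.insertNth_apply_succAbove, Function.update_of_ne (Fin.succAbove_ne k j), w,
          Fin.lt_def]
        split_ifs <;> simp
    rw [ContinuousMultilinearMap.compContinuousLinearMap_apply,
      ContinuousMultilinearMap.curryMid_apply, h3, ← smul_eq_mul,
      ← ContinuousMultilinearMap.map_update_smul, ← hx, ContinuousMultilinearMap.map_update_sub,
      ← h1, ← h2]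
  have htel := Finset.sum_range_sub (fun k => p (n + 1) (w k)) (n + 1)
  rw [← Fin.sum_univ_eq_sum_range (fun k => p (n + 1) (w (k + 1)) - p (n + 1) (w k))] at htel
  simp only [quotientSeries, sum_apply, Finset.mul_sum, key, htel]
  congr 2
  ext i
  simp only [w, if_pos i.2]

theorem norm_quotientSeries_le (p : FormalMultilinearSeries ℝ E ℝ) (P : E →L[ℝ] E) (v : E)
    (n : ℕ) : ‖quotientSeries p P v n‖ ≤
      (n + 1) * (‖p (n + 1)‖ * ‖v‖ * (‖P‖ + 1) ^ n) := by
  have : ∀ k ∈ (Finset.univ : Finset (Fin (n + 1))),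
      ‖((p (n + 1)).curryMid k v).compContinuousLinearMap
        (fun i => if k.succAbove i < k then ContinuousLinearMap.id ℝ E else P)‖
      ≤ ‖p (n + 1)‖ * ‖v‖ * (‖P‖ + 1) ^ n := by
    intro k _
    refine (ContinuousMultilinearMap.norm_compContinuousLinearMap_le _ _).trans ?_
    refine mul_le_mul ?_ ?_ (by positivity) (by positivity)
    · refine ContinuousMultilinearMap.opNorm_le_bound (by positivity) fun m => ?_
      simpa using (p (n + 1)).norm_map_insertNth_le v m
    · refine (Finset.prod_le_prod (g := fun _ => ‖P‖ + 1) (fun i _ => norm_nonneg _)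
        fun i _ => ?_).trans_eq (by simp)
      split_ifs
      · exact ContinuousLinearMap.norm_id_le.trans (by simp)
      · simp
  refine (norm_sum_le _ _).trans ((Finset.sum_le_sum this).trans_eq (by simp))

/-- Hadamard's lemma for analytic functions. -/
theorem exists_sub_eq_mul {f : E → ℝ} (hf : AnalyticAt ℝ f 0) (ℓ : E →L[ℝ] ℝ) (v : E) :
    ∃ q : E → ℝ, AnalyticAt ℝ q 0 ∧ ∀ᶠ x in 𝓝 0, f x = f (x - ℓ x • v) + ℓ x * q x := by
  obtain ⟨p, hp⟩ := hf
  let P : E →L[ℝ] E := ContinuousLinearMap.id ℝ E - ℓ.smulRight v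
  have hP : ∀ x, P x = x - ℓ x • v := fun x => by simp [P]
  let q := quotientSeries p P v
  have hq : 0 < q.radius := by
    obtain ⟨r, hr0, hr⟩ := ENNReal.lt_iff_exists_nnreal_btwn.1 hp.radius_pos
    have hr0' : (0 : ℝ) < r := by exact_mod_cast hr0
    obtain ⟨C, hC, hbd⟩ := p.norm_mul_pow_le_of_lt_radius hr
    let K : ℝ := 2 * (‖P‖ + 1)
    have hK : 0 < K := by positivity
    let s : NNReal := ⟨r / K, by positivity⟩
    have hs : (0 : NNReal) < s := by
      rw [← NNReal.coe_lt_coe]; exact div_pos hr0' hK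
    refine lt_of_lt_of_le (by exact_mod_cast hs) (q.le_radius_of_bound (C * ‖v‖ / r) fun n => ?_)
    have h2 : ((n : ℝ) + 1) ≤ 2 ^ n := by exact_mod_cast Nat.lt_two_pow_self
    calc ‖q n‖ * (s : ℝ) ^ n
        ≤ ((n + 1) * (‖p (n + 1)‖ * ‖v‖ * (‖P‖ + 1) ^ n)) * (r / K) ^ n := by
          gcongr
          · exact norm_quotientSeries_le p P v n
          · exact le_refl _
      _ ≤ (2 ^ n * (‖p (n + 1)‖ * ‖v‖ * (‖P‖ + 1) ^ n)) * (r / K) ^ n := by gcongr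
      _ = (‖p (n + 1)‖ * r ^ (n + 1)) * ‖v‖ / r := by
          simp only [K, div_pow, mul_pow]; field_simp; ring
      _ ≤ C * ‖v‖ / r := by gcongr; exact hbd _
  refine ⟨q.sum, (q.hasFPowerSeriesOnBall hq).analyticAt, ?_⟩
  have hPt : Tendsto P (𝓝 0) (𝓝 0) := by simpa using P.continuous.tendsto 0
  filter_upwards [hp.eventually_hasSum, hPt.eventually hp.eventually_hasSum,
    (q.hasFPowerSeriesOnBall hq).hasFPowerSeriesAt.eventually_hasSum] with x h1 h2 h3
  simp only [zero_add] at h1 h2 h3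
  have h4 := (hasSum_nat_add_iff' 1).2 (h1.sub h2)
  have h5 := h3.mul_left (ℓ x)
  have h6 : ∀ n, ℓ x * q n (fun _ => x) = p (n + 1) (fun _ => x) - p (n + 1) (fun _ => P x) :=
    fun n => quotientSeries_apply p P v (by simp [hP]) n
  simp only [h6] at h5
  have h7 := h4.unique h5
  have h8 : p 0 (fun _ => x) = p 0 (fun _ => P x) := by congr 1; ext i; exact i.elim0
  simp only [Finset.range_one, Finset.sum_singleton, h8, sub_self, sub_zero, hP] at h7
  linarith

theorem exists_eq_mul_of_vanish {f : E → ℝ} (hf : AnalyticAt ℝ f 0) (ℓ : E →L[ℝ] ℝ) (v : E)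
    (h : ∀ᶠ x in 𝓝 0, f (x - ℓ x • v) = 0) :
    ∃ q : E → ℝ, AnalyticAt ℝ q 0 ∧ ∀ᶠ x in 𝓝 0, f x = ℓ x * q x := by
  obtain ⟨q, hq, hfq⟩ := exists_sub_eq_mul hf ℓ v
  exact ⟨q, hq, by filter_upwards [h, hfq] with x h1 h2; simpa [h1] using h2⟩

end General

section Partial

variable {E : Type*} [NormedAddCommGroup E] [NormedSpace ℝ E]

/-- The derivative of `g` in the direction of the second factor. -/
noncomputable def dsnd (g : E × ℝ → ℝ) : E × ℝ → ℝ := fun p => fderiv ℝ g p (0, 1)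

theorem analyticAt_dsnd {g : E × ℝ → ℝ} {p : E × ℝ} (hg : AnalyticAt ℝ g p) :
    AnalyticAt ℝ (dsnd g) p :=
  ((ContinuousLinearMap.apply ℝ ℝ ((0, 1) : E × ℝ)).analyticAt _).comp hg.fderiv

theorem analyticAt_dsnd_iterate {g : E × ℝ → ℝ} {p : E × ℝ} (hg : AnalyticAt ℝ g p) (k : ℕ) :
    AnalyticAt ℝ (dsnd^[k] g) p := by
  induction k generalizing g with
  | zero => simpa using hg
  | succ k ih => exact ih (analyticAt_dsnd hg)

theorem dsnd_congr {g h : E × ℝ → ℝ} {p : E × ℝ} (hgh : g =ᶠ[𝓝 p] h) :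
    dsnd g =ᶠ[𝓝 p] dsnd h :=
  (hgh.fderiv (𝕜 := ℝ)).mono fun x hx => by simp [dsnd, hx]

theorem dsnd_iterate_congr {g h : E × ℝ → ℝ} {p : E × ℝ} (hgh : g =ᶠ[𝓝 p] h) (k : ℕ) :
    dsnd^[k] g =ᶠ[𝓝 p] dsnd^[k] h := by
  induction k generalizing g h with
  | zero => simpa using hgh
  | succ k ih => exact ih (dsnd_congr hgh)

theorem dsnd_eq_deriv {g : E × ℝ → ℝ} {y : E} {t : ℝ} (hg : AnalyticAt ℝ g (y, t)) :
    dsnd g (y, t) = deriv (fun s => g (y, s)) t := by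
  have h1 : HasDerivAt (fun s : ℝ => (y, s)) ((0 : E), (1 : ℝ)) t :=
    (hasDerivAt_const t y).prodMk (hasDerivAt_id t)
  exact (hg.differentiableAt.hasFDerivAt.comp_hasDerivAt t h1).deriv.symm

theorem dsnd_add {a b : E × ℝ → ℝ} {p : E × ℝ} (ha : DifferentiableAt ℝ a p)
    (hb : DifferentiableAt ℝ b p) : dsnd (fun x => a x + b x) p = dsnd a p + dsnd b p := by
  have h : fderiv ℝ (fun x => a x + b x) p = _ := (ha.hasFDerivAt.add hb.hasFDerivAt).fderiv
  simp [dsnd, h]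

theorem dsnd_const_mul {a : E × ℝ → ℝ} {p : E × ℝ} (c : ℝ) (ha : DifferentiableAt ℝ a p) :
    dsnd (fun x => c * a x) p = c * dsnd a p := by
  simp [dsnd, fderiv_const_mul ha]

theorem dsnd_snd_mul {q : E × ℝ → ℝ} {p : E × ℝ} (hq : AnalyticAt ℝ q p) :
    dsnd (fun x => x.2 * q x) p = q p + p.2 * dsnd q p := by
  have h := (hasFDerivAt_snd (𝕜 := ℝ) (p := p)).mul hq.differentiableAt.hasFDerivAt
  have h' : fderiv ℝ (fun x : E × ℝ => x.2 * q x) p = _ := h.fderiv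
  simp [dsnd, h', add_comm]

theorem dsnd_iterate_snd_mul {q : E × ℝ → ℝ} {p : E × ℝ} (hq : AnalyticAt ℝ q p) (k : ℕ) :
    ∀ᶠ x in 𝓝 p, dsnd^[k + 1] (fun x => x.2 * q x) x =
      (k + 1) * dsnd^[k] q x + x.2 * dsnd^[k + 1] q x := by
  induction k with
  | zero =>
    filter_upwards [hq.eventually_analyticAt] with x hx
    simp [dsnd_snd_mul hx]
  | succ k ih =>
    have h1 := dsnd_congr ih
    filter_upwards [h1, hq.eventually_analyticAt] with x hx hxq
    rw [Function.iterate_succ_apply', hx]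
    have ha := analyticAt_dsnd_iterate hxq k
    have hb := analyticAt_dsnd_iterate hxq (k + 1)
    have h2 : dsnd (fun x => x.2 * dsnd^[k + 1] q x) x = _ := dsnd_snd_mul hb
    have h3 : dsnd (fun x => (k + 1) * dsnd^[k] q x + x.2 * dsnd^[k + 1] q x) x =
        (k + 1) * dsnd (dsnd^[k] q) x + dsnd (fun x => x.2 * dsnd^[k + 1] q x) x := by
      rw [dsnd_add (ha.differentiableAt.const_mul _)
        (differentiableAt_snd.fun_mul hb.differentiableAt), dsnd_const_mul _ ha.differentiableAt]
    rw [h3, h2, ← Function.iterate_succ_apply' dsnd k, ← Function.iterate_succ_apply' dsnd (k + 1)]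
    push_cast
    ring

/-- Taylor expansion with analytic remainder in the second variable. -/
theorem exists_taylor {g : E × ℝ → ℝ} (hg : AnalyticAt ℝ g 0) (d : ℕ) :
    ∃ u : E × ℝ → ℝ, AnalyticAt ℝ u 0 ∧ u 0 = dsnd^[d] g 0 / d.factorial ∧
      ∀ᶠ p in 𝓝 (0 : E × ℝ), g p =
        ∑ i ∈ Finset.range d, dsnd^[i] g (p.1, 0) / i.factorial * p.2 ^ i + p.2 ^ d * u p := by
  induction d generalizing g with
  | zero => exact ⟨g, hg, by simp, by simp⟩
  | succ d ih =>
    obtain ⟨q, hq, hgq⟩ := exists_sub_eq_mul hg (ContinuousLinearMap.snd ℝ E ℝ) (0, 1)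
    have hgq' : ∀ᶠ p in 𝓝 (0 : E × ℝ), g p = g (p.1, 0) + p.2 * q p := by
      filter_upwards [hgq] with p hp
      rw [hp]
      congr 2
      ext <;> simp
    have hproj : Tendsto (fun p : E × ℝ => (p.1, (0 : ℝ))) (𝓝 0) (𝓝 0) :=
      (show Continuous fun p : E × ℝ => (p.1, (0 : ℝ)) by fun_prop).tendsto' _ _ (by simp)
    have hg0 : AnalyticAt ℝ (fun p : E × ℝ => g (p.1, 0)) 0 :=
      AnalyticAt.fun_comp (g := g) (f := fun p : E × ℝ => (p.1, (0 : ℝ))) hg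
        (analyticAt_fst.prod analyticAt_const)
    have hd1 : dsnd g =ᶠ[𝓝 0] dsnd (fun p => p.2 * q p) := by
      refine (dsnd_congr hgq').trans ?_
      filter_upwards [hg0.eventually_analyticAt, hq.eventually_analyticAt] with p hp hpq
      have h0 : dsnd (fun p : E × ℝ => g (p.1, 0)) p = 0 := by
        rw [show p = (p.1, p.2) from rfl, dsnd_eq_deriv hp]; simp
      rw [dsnd_add hp.differentiableAt (differentiableAt_snd.fun_mul hpq.differentiableAt), h0,
        zero_add]
    have hder : ∀ k, ∀ᶠ p in 𝓝 (0 : E × ℝ), dsnd^[k + 1] g p =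
        (k + 1) * dsnd^[k] q p + p.2 * dsnd^[k + 1] q p := by
      intro k
      filter_upwards [dsnd_iterate_congr hd1 k, dsnd_iterate_snd_mul hq k] with p h1 h2
      rw [Function.iterate_succ_apply, h1, ← h2, Function.iterate_succ_apply]
    obtain ⟨u, hu, hu0, hqu⟩ := ih hq
    refine ⟨u, hu, ?_, ?_⟩
    · have := (hder d).self_of_nhds
      rw [hu0, this, Nat.factorial_succ]
      have : ((d : ℝ) + 1) ≠ 0 := by positivity
      push_cast
      simp only [Prod.snd_zero, zero_mul, add_zero]
      field_simp
    · have hall : ∀ᶠ p in 𝓝 (0 : E × ℝ), ∀ k ∈ Finset.range d, dsnd^[k + 1] g (p.1, 0) =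
          (k + 1) * dsnd^[k] q (p.1, 0) :=
        (eventually_all_finset _).2 fun k _ => by
          filter_upwards [hproj.eventually (hder k)] with p hp
          simpa using hp
      filter_upwards [hgq', hqu, hall] with p h1 h2 h3
      rw [h1, h2, Finset.sum_range_succ', mul_add, Finset.mul_sum]
      have : ∀ i ∈ Finset.range d, p.2 * (dsnd^[i] q (p.1, 0) / i.factorial * p.2 ^ i) =
          dsnd^[i + 1] g (p.1, 0) / (i + 1).factorial * p.2 ^ (i + 1) := by
        intro i hi
        rw [h3 i hi, Nat.factorial_succ]
        have : ((i : ℝ) + 1) ≠ 0 := by positivity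
        push_cast
        field_simp
        ring
      rw [Finset.sum_congr rfl this]
      simp only [Function.iterate_zero, id_eq, Nat.factorial_zero, Nat.cast_one, div_one, pow_zero,
        mul_one]
      ring

theorem exists_implicit [CompleteSpace E] {h : E × ℝ → ℝ} (hh : AnalyticAt ℝ h 0) (h0 : h 0 = 0)
    (hd : dsnd h 0 ≠ 0) :
    ∃ τ : E → ℝ, AnalyticAt ℝ τ 0 ∧ τ 0 = 0 ∧ ∀ᶠ y in 𝓝 0, h (y, τ y) = 0 := by
  have cd : ContDiffAt ℝ ⊤ h 0 := hh.contDiffAt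
  have hinv : (fderiv ℝ h 0 ∘L .inr ℝ E ℝ).IsInvertible := by
    refine ⟨ContinuousLinearEquiv.unitsEquivAut ℝ (Units.mk0 _ hd), ?_⟩
    ext
    simp [dsnd]
  refine ⟨cd.implicitFunction (by simp) hinv, ?_, ?_, ?_⟩
  · exact (cd.contDiffAt_implicitFunction (by simp) hinv).analyticAt
  · exact cd.implicitFunction_apply_self (by simp) hinv
  · simpa [h0] using cd.eventually_apply_implicitFunction (by simp) hinv

end Partial

section NormalCrossings

variable {ι : Type*} [Fintype ι]

/-- The monomial `∏ i, x i ^ α i`. -/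
def monom (α : ι → ℕ) (x : ι → ℝ) : ℝ := ∏ i, x i ^ α i

theorem monom_add (α β : ι → ℕ) (x : ι → ℝ) : monom (α + β) x = monom α x * monom β x := by
  simp [monom, pow_add, Finset.prod_mul_distrib]

theorem monom_smul (n : ℕ) (α : ι → ℕ) (x : ι → ℝ) : monom (n • α) x = monom α x ^ n := by
  simp [monom, Finset.prod_pow, pow_mul']

@[simp] theorem monom_zero (x : ι → ℝ) : monom 0 x = 1 := by simp [monom]

theorem monom_single [DecidableEq ι] (k : ι) (x : ι → ℝ) : monom (Pi.single k 1) x = x k := by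
  rw [monom, Finset.prod_eq_single k] <;> simp +contextual

theorem monom_at_zero {α : ι → ℕ} (hα : α ≠ 0) : monom α (0 : ι → ℝ) = 0 := by
  obtain ⟨k, hk⟩ := Function.ne_iff.1 hα
  exact Finset.prod_eq_zero (Finset.mem_univ k) (by simpa using hk)

theorem analyticAt_coord (k : ι) (x : ι → ℝ) : AnalyticAt ℝ (fun x : ι → ℝ => x k) x :=
  (ContinuousLinearMap.proj (R := ℝ) (φ := fun _ : ι => ℝ) k).analyticAt x

theorem analyticAt_monom (α : ι → ℕ) (x : ι → ℝ) : AnalyticAt ℝ (monom α) x :=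
  Finset.analyticAt_fun_prod _ fun i _ => (analyticAt_coord i x).pow (α i)

theorem eq_add_single {ι : Type*} [DecidableEq ι] {α : ι → ℕ} {k : ι} (hk : α k ≠ 0) :
    ∃ β : ι → ℕ, α = β + Pi.single k 1 := by
  refine ⟨α - Pi.single k 1, (tsub_add_cancel_of_le fun i => ?_).symm⟩
  rcases eq_or_ne i k with rfl | h
  · simpa using Nat.one_le_iff_ne_zero.2 hk
  · simp [h]

/-- Near the origin, `f` is a monomial times an analytic unit. -/
def IsNormalCrossing (f : (ι → ℝ) → ℝ) : Prop :=
  ∃ (α : ι → ℕ) (u : (ι → ℝ) → ℝ), AnalyticAt ℝ u 0 ∧ u 0 ≠ 0 ∧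
    ∀ᶠ x in 𝓝 0, f x = monom α x * u x

namespace IsNormalCrossing

theorem congr {f g : (ι → ℝ) → ℝ} (hf : IsNormalCrossing f) (h : ∀ᶠ x in 𝓝 0, g x = f x) :
    IsNormalCrossing g := by
  obtain ⟨α, u, hu, hu0, hfu⟩ := hf
  exact ⟨α, u, hu, hu0, by filter_upwards [h, hfu] with x h1 h2; rw [h1, h2]⟩

theorem of_unit {u : (ι → ℝ) → ℝ} (hu : AnalyticAt ℝ u 0) (h0 : u 0 ≠ 0) : IsNormalCrossing u :=
  ⟨0, u, hu, h0, by simp⟩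

theorem coord (k : ι) : IsNormalCrossing fun x : ι → ℝ => x k := by
  classical
  exact ⟨Pi.single k 1, fun _ => 1, analyticAt_const, one_ne_zero, by simp [monom_single]⟩

theorem mul {f g : (ι → ℝ) → ℝ} (hf : IsNormalCrossing f) (hg : IsNormalCrossing g) :
    IsNormalCrossing fun x => f x * g x := by
  obtain ⟨α, u, hu, hu0, hfu⟩ := hf
  obtain ⟨β, v, hv, hv0, hgv⟩ := hg
  refine ⟨α + β, fun x => u x * v x, hu.mul hv, mul_ne_zero hu0 hv0, ?_⟩
  filter_upwards [hfu, hgv] with x h1 h2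
  rw [h1, h2, monom_add]; ring

theorem pow {f : (ι → ℝ) → ℝ} (hf : IsNormalCrossing f) (n : ℕ) :
    IsNormalCrossing fun x => f x ^ n := by
  induction n with
  | zero => simpa using of_unit analyticAt_const one_ne_zero
  | succ n ih => simpa [pow_succ] using ih.mul hf

theorem prod {κ : Type*} (s : Finset κ) {f : κ → (ι → ℝ) → ℝ}
    (hf : ∀ k ∈ s, IsNormalCrossing (f k)) : IsNormalCrossing fun x => ∏ k ∈ s, f k x := by
  classical
  induction s using Finset.induction_on with
  | empty => simpa using of_unit analyticAt_const one_ne_zero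
  | insert k s hk ih =>
    simpa [Finset.prod_insert hk] using
      (hf k (by simp)).mul (ih fun i hi => hf i (by simp [hi]))

theorem not_eventually_eq_zero {f : (ι → ℝ) → ℝ} (hf : IsNormalCrossing f) :
    ¬ ∀ᶠ x in 𝓝 0, f x = 0 := by
  obtain ⟨α, u, hu, hu0, hfu⟩ := hf
  intro h
  have hcoord : ∀ k : ι, ¬ ∀ᶠ x : ι → ℝ in 𝓝 0, x k = 0 := by
    intro k hk
    have ht : Tendsto (fun s : ℝ => fun _ : ι => s) (𝓝[≠] 0) (𝓝 0) :=
      ((show Continuous fun s : ℝ => fun _ : ι => s by fun_prop).tendsto' _ _ rfl).mono_left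
        nhdsWithin_le_nhds
    obtain ⟨s, hs, hs'⟩ := ((ht.eventually hk).and self_mem_nhdsWithin).exists
    exact hs' hs
  have hmon := not_eventually_prod_eq_zero Finset.univ
    (fun k _ => (analyticAt_coord k (0 : ι → ℝ)).pow (α k))
    (fun k _ hk => hcoord k (hk.mono fun x hx => eq_zero_of_pow_eq_zero hx))
  rcases eventually_eq_zero_or_of_mul (analyticAt_monom α 0) hu
    (by filter_upwards [h, hfu] with x h1 h2; rw [← h2, h1]) with h | h
  · exact hmon h
  · exact hu0 h.self_of_nhds

theorem of_mul {f g : (ι → ℝ) → ℝ} (hf : AnalyticAt ℝ f 0) (hg : AnalyticAt ℝ g 0)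
    (h : IsNormalCrossing fun x => f x * g x) : IsNormalCrossing f := by
  classical
  obtain ⟨α, u, hu, hu0, hfg⟩ := h
  obtain ⟨N, hN⟩ : ∃ N, ∑ k, α k = N := ⟨_, rfl⟩
  induction N generalizing α f g with
  | zero =>
    have hα : α = 0 := by
      ext k; exact (Finset.sum_eq_zero_iff.1 hN) k (Finset.mem_univ k)
    subst hα
    have h0 := hfg.self_of_nhds
    simp only [monom_zero, one_mul] at h0
    exact of_unit hf (left_ne_zero_of_mul (h0 ▸ hu0))
  | succ N ih =>
    obtain ⟨k, hk⟩ : ∃ k, α k ≠ 0 := by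
      by_contra! hall
      simp [hall] at hN
    obtain ⟨β, rfl⟩ := eq_add_single hk
    have hβ : ∑ k, β k = N := by
      simpa [Finset.sum_add_distrib] using hN
    let ℓ := ContinuousLinearMap.proj (R := ℝ) (φ := fun _ : ι => ℝ) k
    let e : ι → ℝ := Pi.single k 1
    let P : (ι → ℝ) →L[ℝ] (ι → ℝ) := ContinuousLinearMap.id ℝ _ - ℓ.smulRight e
    have hP : ∀ x, P x = x - ℓ x • e := fun x => by simp [P]
    have hPk : ∀ x, P x k = 0 := fun x => by simp [hP, ℓ, e]
    have hPt : Tendsto P (𝓝 0) (𝓝 0) := by simpa using P.continuous.tendsto 0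
    have hPa : ∀ {q : (ι → ℝ) → ℝ}, AnalyticAt ℝ q 0 → AnalyticAt ℝ (fun x => q (P x)) 0 :=
      fun {q} hq => AnalyticAt.fun_comp (by simpa using hq) (P.analyticAt 0)
    have hsplit : ∀ x, monom (β + Pi.single k 1) x = x k * monom β x := fun x => by
      rw [monom_add, monom_single, mul_comm]
    have hxk : ¬ ∀ᶠ x : ι → ℝ in 𝓝 0, x k = 0 := (coord k).not_eventually_eq_zero
    have hvan : ∀ᶠ x in 𝓝 0, f (P x) * g (P x) = 0 := by
      filter_upwards [hPt.eventually hfg] with x hx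
      rw [hx, hsplit, hPk]; ring
    rcases eventually_eq_zero_or_of_mul (hPa hf) (hPa hg) hvan with h0 | h0
    · obtain ⟨q, hq, hfq⟩ := exists_eq_mul_of_vanish hf ℓ e (by simpa only [hP] using h0)
      have hqg : ∀ᶠ x in 𝓝 0, q x * g x = monom β x * u x := by
        refine eventuallyEq_of_mul_left (analyticAt_coord k 0) (hq.mul hg)
          ((analyticAt_monom β 0).mul hu) hxk ?_
        filter_upwards [hfq, hfg] with x h1 h2
        rw [h1, hsplit] at h2
        simp only [ℓ, ContinuousLinearMap.proj_apply] at h2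
        linear_combination h2
      exact ((coord k).mul (ih hq hg β hqg hβ)).congr hfq
    · obtain ⟨q, hq, hgq⟩ := exists_eq_mul_of_vanish hg ℓ e (by simpa only [hP] using h0)
      have hqg : ∀ᶠ x in 𝓝 0, f x * q x = monom β x * u x := by
        refine eventuallyEq_of_mul_left (analyticAt_coord k 0) (hf.mul hq)
          ((analyticAt_monom β 0).mul hu) hxk ?_
        filter_upwards [hgq, hfg] with x h1 h2
        rw [h1, hsplit] at h2
        simp only [ℓ, ContinuousLinearMap.proj_apply] at h2
        linear_combination h2
      exact ih hf hq β hqg hβ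

theorem of_prod {κ : Type*} {s : Finset κ} {f : κ → (ι → ℝ) → ℝ}
    (hf : ∀ k ∈ s, AnalyticAt ℝ (f k) 0) (h : IsNormalCrossing fun x => ∏ k ∈ s, f k x)
    {k : κ} (hk : k ∈ s) : IsNormalCrossing (f k) := by
  classical
  refine of_mul (g := fun x => ∏ i ∈ s.erase k, f i x) (hf k hk)
    (Finset.analyticAt_fun_prod _ fun i hi => hf i (Finset.mem_of_mem_erase hi)) ?_
  exact h.congr (Eventually.of_forall fun x => Finset.mul_prod_erase s (fun i => f i x) hk)

end IsNormalCrossing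

theorem eq_of_pow_mul_eventuallyEq {a b : ℕ} {p q : ℝ → ℝ} {p0 q0 : ℝ} (hp0 : p0 ≠ 0)
    (hq0 : q0 ≠ 0) (hp : Tendsto p (𝓝[>] 0) (𝓝 p0)) (hq : Tendsto q (𝓝[>] 0) (𝓝 q0))
    (h : ∀ᶠ s in 𝓝[>] (0 : ℝ), s ^ a * p s = s ^ b * q s) : a = b := by
  wlog hab : a ≤ b generalizing a b p q p0 q0
  · exact (this hq0 hp0 hq hp (h.mono fun s hs => hs.symm) (le_of_not_ge hab)).symm
  by_contra hne
  have hlt : b - a ≠ 0 := by omega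
  have hs0 : Tendsto (fun s : ℝ => s) (𝓝[>] 0) (𝓝 0) := tendsto_id.mono_left nhdsWithin_le_nhds
  have h1 : Tendsto (fun s : ℝ => s ^ (b - a) * q s) (𝓝[>] 0) (𝓝 0) := by
    simpa [hlt] using (hs0.pow (b - a)).mul hq
  refine hp0 (tendsto_nhds_unique (hp.congr' ?_) h1)
  filter_upwards [h, self_mem_nhdsWithin] with s hs hs'
  have hs' : (0 : ℝ) < s := hs'
  have : s ^ b = s ^ a * s ^ (b - a) := by rw [← pow_add]; congr 1; omega
  rw [this, mul_assoc] at hs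
  exact mul_left_cancel₀ (by positivity) hs

theorem monom_curve (α m : ι → ℕ) (s : ℝ) : monom α (fun k => s ^ m k) = s ^ ∑ k, m k * α k := by
  simp [monom, ← pow_mul, Finset.prod_pow_eq_pow_sum]

theorem tendsto_curve {ι : Type*} {m : ι → ℕ} (hm : ∀ k, m k ≠ 0) :
    Tendsto (fun s : ℝ => fun k => s ^ m k) (𝓝[>] 0) (𝓝 0) :=
  ((show Continuous fun s : ℝ => fun k => s ^ m k by fun_prop).tendsto' _ _
    (by ext k; simp [hm k])).mono_left nhdsWithin_le_nhds

theorem weight_eq_of_lt {α β γ m : ι → ℕ} {u v w : (ι → ℝ) → ℝ} (hu : ContinuousAt u 0)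
    (hv : ContinuousAt v 0) (hw : ContinuousAt w 0) (hu0 : u 0 ≠ 0)
    (h : ∀ᶠ x in 𝓝 0, monom α x * u x - monom β x * v x = monom γ x * w x)
    (hm : ∀ k, m k ≠ 0) (hlt : ∑ k, m k * α k < ∑ k, m k * β k) :
    w 0 ≠ 0 → ∑ k, m k * γ k = ∑ k, m k * α k := by
  intro hw0
  have hc := tendsto_curve hm
  have hs0 : Tendsto (fun s : ℝ => s) (𝓝[>] 0) (𝓝 0) := tendsto_id.mono_left nhdsWithin_le_nhds
  have hb : ∑ k, m k * β k - ∑ k, m k * α k ≠ 0 := by omega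
  have h1 : Tendsto (fun s : ℝ => u (fun k => s ^ m k) -
      s ^ (∑ k, m k * β k - ∑ k, m k * α k) * v (fun k => s ^ m k)) (𝓝[>] 0) (𝓝 (u 0)) := by
    simpa [hb] using (hu.tendsto.comp hc).sub ((hs0.pow (∑ k, m k * β k - ∑ k, m k * α k)).mul (hv.tendsto.comp hc))
  refine (eq_of_pow_mul_eventuallyEq hu0 hw0 h1 (hw.tendsto.comp hc) ?_).symm
  filter_upwards [hc.eventually h] with s hs
  simp only [monom_curve] at hs
  have : s ^ (∑ k, m k * β k) =
      s ^ (∑ k, m k * α k) * s ^ (∑ k, m k * β k - ∑ k, m k * α k) := by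
    rw [← pow_add]; congr 1; omega
  rw [this] at hs
  simp only [Function.comp]
  linear_combination hs

theorem weight_eq_of_eventuallyEq {α β m : ι → ℕ} {u v : (ι → ℝ) → ℝ} (hu : ContinuousAt u 0)
    (hv : ContinuousAt v 0) (hu0 : u 0 ≠ 0) (hv0 : v 0 ≠ 0)
    (h : ∀ᶠ x in 𝓝 0, monom α x * u x = monom β x * v x)
    (hm : ∀ k, m k ≠ 0) : ∑ k, m k * α k = ∑ k, m k * β k := by
  have hc := tendsto_curve hm
  refine eq_of_pow_mul_eventuallyEq hu0 hv0 (hu.tendsto.comp hc) (hv.tendsto.comp hc) ?_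
  filter_upwards [hc.eventually h] with s hs
  simpa only [monom_curve, Function.comp] using hs

/-- If two monomials times units have a difference which is a monomial times a unit, then one of
the two monomials divides the other. -/
theorem exponents_comparable {α β : ι → ℕ} {u v : (ι → ℝ) → ℝ} (hu : ContinuousAt u 0)
    (hv : ContinuousAt v 0) (hu0 : u 0 ≠ 0) (hv0 : v 0 ≠ 0)
    (h : (∀ᶠ x in 𝓝 0, monom α x * u x - monom β x * v x = 0) ∨
      IsNormalCrossing fun x => monom α x * u x - monom β x * v x) : α ≤ β ∨ β ≤ α := by
  classical
  by_contra! hne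
  obtain ⟨h1, h2⟩ := hne
  obtain ⟨i, hi⟩ := not_forall.1 h1
  obtain ⟨j, hj⟩ := not_forall.1 h2
  have hi : β i < α i := lt_of_not_ge hi
  have hj : α j < β j := lt_of_not_ge hj
  have hij : i ≠ j := by rintro rfl; omega
  let m : ℕ → ℕ → ι → ℕ := fun a b => 1 + a • Pi.single i 1 + b • Pi.single j 1
  have hm : ∀ a b k, m a b k ≠ 0 := fun a b k => by simp [m]
  have hsum : ∀ (a b : ℕ) (δ : ι → ℕ), ∑ k, m a b k * δ k = ∑ k, δ k + a * δ i + b * δ j := by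
    intro a b δ
    simp [m, add_mul, Finset.sum_add_distrib, Pi.single_apply]
  rcases h with h | ⟨γ, w, hw, hw0, h⟩
  · have h' : ∀ᶠ x in 𝓝 0, monom α x * u x = monom β x * v x := h.mono fun x hx => sub_eq_zero.1 hx
    have e0 := weight_eq_of_eventuallyEq hu hv hu0 hv0 h' (hm 0 0)
    have e1 := weight_eq_of_eventuallyEq hu hv hu0 hv0 h' (hm 1 0)
    simp only [hsum] at e0 e1
    omega
  · have hα : ∀ a b, ∑ k, m a b k * α k < ∑ k, m a b k * β k →
        ∑ k, m a b k * γ k = ∑ k, m a b k * α k := fun a b hlt =>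
      weight_eq_of_lt hu hv hw.continuousAt hu0 h (hm a b) hlt hw0
    have hβ : ∀ a b, ∑ k, m a b k * β k < ∑ k, m a b k * α k →
        ∑ k, m a b k * γ k = ∑ k, m a b k * β k := fun a b hlt =>
      weight_eq_of_lt (u := v) (v := u) (w := fun x => - w x) hv hu hw.continuousAt.neg hv0
        (h.mono fun x hx => by linear_combination -hx) (hm a b) hlt (neg_ne_zero.2 hw0)
    simp only [hsum] at hα hβ
    have key1 : γ j = β j := by
      have hle : ∀ a : ℕ, a * β i + a ≤ a * α i := fun a => by nlinarith
      have e0 := hβ (∑ k, β k + β j + 1) 0 (by have := hle (∑ k, β k + β j + 1); omega)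
      have e1 := hβ (∑ k, β k + β j + 1) 1 (by have := hle (∑ k, β k + β j + 1); omega)
      linarith
    have key2 : γ j = α j := by
      have hle : ∀ b : ℕ, b * α j + b ≤ b * β j := fun b => by nlinarith
      have e0 := hα 0 (∑ k, α k + 1) (by have := hle (∑ k, α k + 1); omega)
      have e1 := hα 0 (∑ k, α k + 1 + 1) (by have := hle (∑ k, α k + 1 + 1); omega)
      linarith
    omega

end NormalCrossings

section Lifts

variable {E F G : Type*} [NormedAddCommGroup E] [NormedSpace ℝ E] [NormedAddCommGroup F]
  [NormedSpace ℝ F] [NormedAddCommGroup G] [NormedSpace ℝ G]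

/-- The analytic germ `φ` fixes the origin and, along the ultrafilter `𝒰`, has a right inverse `σ`
converging to the origin. -/
structure IsLift (𝒰 : Ultrafilter F) (φ : E → F) (σ : F → E) : Prop where
  analyticAt : AnalyticAt ℝ φ 0
  map_zero : φ 0 = 0
  tendsto : Tendsto σ 𝒰 (𝓝 0)
  eventually_eq : ∀ᶠ x in (𝒰 : Filter F), φ (σ x) = x

namespace IsLift

variable {𝒰 : Ultrafilter F} {φ : E → F} {σ : F → E}

theorem tendsto_chart (h : IsLift 𝒰 φ σ) : Tendsto φ (𝓝 0) (𝓝 0) := by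
  simpa only [h.map_zero] using h.analyticAt.continuousAt.tendsto

theorem map_le (h : IsLift 𝒰 φ σ) : ((𝒰.map σ : Ultrafilter E) : Filter E) ≤ 𝓝 0 := h.tendsto

theorem comp_analyticAt (h : IsLift 𝒰 φ σ) {f : F → G} (hf : AnalyticAt ℝ f 0) :
    AnalyticAt ℝ (fun y => f (φ y)) 0 :=
  AnalyticAt.fun_comp (by rwa [h.map_zero]) h.analyticAt

theorem comp {φ' : G → E} {σ' : E → G} (h : IsLift 𝒰 φ σ) (h' : IsLift (𝒰.map σ) φ' σ') :
    IsLift 𝒰 (fun y => φ (φ' y)) (fun x => σ' (σ x)) where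
  analyticAt := h'.comp_analyticAt h.analyticAt
  map_zero := by rw [h'.map_zero, h.map_zero]
  tendsto := h'.tendsto.comp tendsto_map
  eventually_eq := by
    have h1 : ∀ᶠ x in (𝒰 : Filter F), φ' (σ' (σ x)) = σ x := h'.eventually_eq
    filter_upwards [h1, h.eventually_eq] with x h1 h2
    rw [h1, h2]

theorem of_equiv (h𝒰 : (𝒰 : Filter F) ≤ 𝓝 0) (L : E ≃L[ℝ] F) : IsLift 𝒰 L L.symm where
  analyticAt := L.toContinuousLinearMap.analyticAt 0
  map_zero := L.map_zero
  tendsto := Tendsto.mono_left (by simpa using L.symm.continuous.tendsto 0) h𝒰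
  eventually_eq := Eventually.of_forall fun x => L.apply_symm_apply x

theorem prodMap {𝒱 : Ultrafilter (F × G)} (h𝒱 : (𝒱 : Filter (F × G)) ≤ 𝓝 0)
    (h : IsLift (𝒱.map Prod.fst) φ σ) :
    IsLift 𝒱 (fun p : E × G => (φ p.1, p.2)) (fun p => (σ p.1, p.2)) where
  analyticAt := (AnalyticAt.fun_comp (f := Prod.fst) (x := (0 : E × G)) h.analyticAt
    analyticAt_fst).prod analyticAt_snd
  map_zero := by simp [h.map_zero]
  tendsto := by
    rw [← Prod.mk_zero_zero]
    exact (h.tendsto.comp tendsto_map).prodMk_nhds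
      ((continuous_snd.tendsto' (0 : F × G) 0 rfl).mono_left h𝒱)
  eventually_eq := by
    have h1 : ∀ᶠ p in (𝒱 : Filter (F × G)), φ (σ p.1) = p.1 := h.eventually_eq
    filter_upwards [h1] with p h1
    rw [h1]

end IsLift

/-- Along `𝒰`, the germ `g` becomes a normal crossing after an analytic substitution. -/
def HasResolution (ι : Type*) [Fintype ι] (𝒰 : Ultrafilter F) (g : F → ℝ) : Prop :=
  ∃ (φ : (ι → ℝ) → F) (σ : F → ι → ℝ), IsLift 𝒰 φ σ ∧ IsNormalCrossing fun y => g (φ y)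

variable {ι κ : Type*} [Fintype ι] [Fintype κ]

namespace HasResolution

variable {𝒰 : Ultrafilter F} {φ : E → F} {σ : F → E} {g g' : F → ℝ}

theorem of_lift (h : IsLift 𝒰 φ σ) (hg : HasResolution ι (𝒰.map σ) fun y => g (φ y)) :
    HasResolution ι 𝒰 g := by
  obtain ⟨φ', σ', h', hn⟩ := hg
  exact ⟨_, _, h.comp h', hn⟩

theorem congr (hg : HasResolution ι 𝒰 g) (h : ∀ᶠ x in 𝓝 0, g' x = g x) :
    HasResolution ι 𝒰 g' := by
  obtain ⟨φ, σ, h', hn⟩ := hg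
  exact ⟨φ, σ, h', hn.congr (h'.tendsto_chart.eventually h)⟩

end HasResolution

/-- Every nonzero analytic germ on `F` becomes a normal crossing along every ultrafilter converging
to the origin. -/
def Monomializable (ι F : Type*) [Fintype ι] [NormedAddCommGroup F] [NormedSpace ℝ F] : Prop :=
  ∀ g : F → ℝ, AnalyticAt ℝ g 0 → (¬ ∀ᶠ x in 𝓝 0, g x = 0) →
    ∀ 𝒰 : Ultrafilter F, (𝒰 : Filter F) ≤ 𝓝 0 → HasResolution ι 𝒰 g

theorem Monomializable.family {β : Type*} [Fintype β] (hM : Monomializable ι F) {f : β → F → ℝ}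
    (hf : ∀ k, AnalyticAt ℝ (f k) 0) (𝒰 : Ultrafilter F) (h𝒰 : (𝒰 : Filter F) ≤ 𝓝 0) :
    ∃ (φ : (ι → ℝ) → F) (σ : F → ι → ℝ), IsLift 𝒰 φ σ ∧
      ∀ k, (¬ ∀ᶠ x in 𝓝 0, f k x = 0) → IsNormalCrossing fun y => f k (φ y) := by
  classical
  let s : Finset β := Finset.univ.filter fun k => ¬ ∀ᶠ x in 𝓝 0, f k x = 0
  obtain ⟨φ, σ, hφ, hn⟩ := hM (fun x => ∏ k ∈ s, f k x)
    (Finset.analyticAt_fun_prod _ fun k _ => hf k)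
    (not_eventually_prod_eq_zero s (fun k _ => hf k) fun k hk => (Finset.mem_filter.1 hk).2) 𝒰 h𝒰
  exact ⟨φ, σ, hφ, fun k hk => IsNormalCrossing.of_prod (f := fun k y => f k (φ y))
    (fun k _ => hφ.comp_analyticAt (hf k)) hn (Finset.mem_filter.2 ⟨Finset.mem_univ k, hk⟩)⟩

theorem IsNormalCrossing.comp {f : (ι → ℝ) → ℝ} (hf : IsNormalCrossing f)
    {φ : (κ → ℝ) → ι → ℝ} (hφ : AnalyticAt ℝ φ 0) (h0 : φ 0 = 0)
    (hk : ∀ i, IsNormalCrossing fun y => φ y i) : IsNormalCrossing fun y => f (φ y) := by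
  obtain ⟨α, u, hu, hu0, hfu⟩ := hf
  have ht : Tendsto φ (𝓝 0) (𝓝 0) := by simpa only [h0] using hφ.continuousAt.tendsto
  refine IsNormalCrossing.congr (f := fun y => monom α (φ y) * u (φ y)) ?_ (ht.eventually hfu)
  exact (IsNormalCrossing.prod Finset.univ fun i _ => (hk i).pow (α i)).mul
    (.of_unit (AnalyticAt.fun_comp (by rwa [h0]) hφ) (by rwa [h0]))

theorem exists_pow_lift (𝒰 : Ultrafilter (ι → ℝ)) (h𝒰 : (𝒰 : Filter (ι → ℝ)) ≤ 𝓝 0) {N : ℕ}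
    (hN : N ≠ 0) : ∃ (ε : ι → ℝ) (σ : (ι → ℝ) → ι → ℝ), (∀ k, ε k ≠ 0) ∧
      IsLift 𝒰 (fun w k => ε k * w k ^ N) σ := by
  have hsign : ∀ k, ∃ e : ℝ, e ≠ 0 ∧ ∀ᶠ y in (𝒰 : Filter (ι → ℝ)), e * |y k| = y k := by
    intro k
    rcases 𝒰.eventually_or.1 (Eventually.of_forall fun y : ι → ℝ => le_total 0 (y k)) with h | h
    · exact ⟨1, one_ne_zero, h.mono fun y hy => by rw [abs_of_nonneg hy, one_mul]⟩
    · exact ⟨-1, by norm_num, h.mono fun y hy => by rw [abs_of_nonpos hy]; ring⟩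
  choose ε hε0 hε using hsign
  refine ⟨ε, fun y k => |y k| ^ (1 / N : ℝ), hε0, ?_, ?_, ?_, ?_⟩
  · exact AnalyticAt.pi fun k => analyticAt_const.mul ((analyticAt_coord k 0).pow N)
  · ext k; simp [hN]
  · refine Tendsto.mono_left (Continuous.tendsto' ?_ _ _ ?_) h𝒰
    · exact continuous_pi fun k => (continuous_apply k).abs.rpow_const fun _ => .inr (by positivity)
    · ext k; simp [hN]
  · filter_upwards [eventually_all.2 hε] with y hy
    ext k
    rw [← Real.rpow_natCast, ← Real.rpow_mul (abs_nonneg _), one_div,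
      inv_mul_cancel₀ (by exact_mod_cast hN), Real.rpow_one, hy]

theorem monom_mul_pow (α : ι → ℕ) (ε : ι → ℝ) (N : ℕ) (w : ι → ℝ) :
    monom α (fun k => ε k * w k ^ N) = monom α ε * monom (N • α) w := by
  simp [monom, mul_pow, Finset.prod_mul_distrib, ← pow_mul]

theorem monom_ne_zero (α : ι → ℕ) {ε : ι → ℝ} (h : ∀ k, ε k ≠ 0) : monom α ε ≠ 0 :=
  Finset.prod_ne_zero_iff.2 fun k _ => pow_ne_zero _ (h k)

theorem Monomializable.exists_prepared (hM : Monomializable ι (ι → ℝ)) {d : ℕ}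
    {h : (ι → ℝ) → ℝ} (hh : AnalyticAt ℝ h 0) (hh0 : ¬ ∀ᶠ x in 𝓝 0, h x = 0)
    {c : Fin d → (ι → ℝ) → ℝ} (hc : ∀ i, AnalyticAt ℝ (c i) 0) (hc0 : ∀ i, c i 0 = 0)
    (hne : ∃ i, ¬ ∀ᶠ x in 𝓝 0, c i x = 0)
    (𝒰 : Ultrafilter (ι → ℝ)) (h𝒰 : (𝒰 : Filter (ι → ℝ)) ≤ 𝓝 0) :
    ∃ (ψ σ : (ι → ℝ) → ι → ℝ) (γ : ι → ℕ) (b : Fin d → (ι → ℝ) → ℝ), IsLift 𝒰 ψ σ ∧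
      (IsNormalCrossing fun w => h (ψ w)) ∧ γ ≠ 0 ∧ (∀ i, AnalyticAt ℝ (b i) 0) ∧
      (∀ i, ∀ᶠ w in 𝓝 0, c i (ψ w) = monom γ w ^ (d - i : ℕ) * b i w) ∧
      (∀ i, (∀ᶠ x in 𝓝 0, c i x = 0) → b i 0 = 0) ∧ ∃ i, b i 0 ≠ 0 := by
  classical
  let N := d.factorial
  have hN : N ≠ 0 := d.factorial_ne_zero
  let e : Fin d → ℕ := fun i => N / (d - i)
  have he : ∀ i : Fin d, e i * (d - i) = N := fun i =>
    Nat.div_mul_cancel (Nat.dvd_factorial (by omega) (by omega))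
  have he0 : ∀ i, e i ≠ 0 := fun i h => hN (by rw [← he i, h, zero_mul])
  obtain ⟨φ, σ, hφ, hfam⟩ := hM.family
    (f := Sum.elim (fun _ : Unit => h) (Sum.elim c
      fun ij : Fin d × Fin d => fun x => c ij.1 x ^ e ij.1 - c ij.2 x ^ e ij.2))
    (by
      rintro (_ | i | ⟨i, j⟩)
      · exact hh
      · exact hc i
      · exact ((hc i).pow _).sub ((hc j).pow _)) 𝒰 h𝒰
  have hnh : IsNormalCrossing fun y => h (φ y) := hfam (.inl ()) hh0
  have hnc : ∀ i, (¬ ∀ᶠ x in 𝓝 0, c i x = 0) → IsNormalCrossing fun y => c i (φ y) :=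
    fun i => hfam (.inr (.inl i))
  have hnd : ∀ i j, (∀ᶠ y in 𝓝 0, c i (φ y) ^ e i - c j (φ y) ^ e j = 0) ∨
      IsNormalCrossing fun y => c i (φ y) ^ e i - c j (φ y) ^ e j := by
    intro i j
    by_cases hz : ∀ᶠ x in 𝓝 0, c i x ^ e i - c j x ^ e j = 0
    · exact .inl (hφ.tendsto_chart.eventually hz)
    · exact .inr (hfam (.inr (.inr (i, j))) hz)
  let Z : Fin d → Prop := fun i => ∀ᶠ x in 𝓝 0, c i x = 0
  have hex : ∀ i, ∃ (α : ι → ℕ) (u : (ι → ℝ) → ℝ), AnalyticAt ℝ u 0 ∧ (¬ Z i → u 0 ≠ 0) ∧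
      (∀ᶠ y in 𝓝 0, c i (φ y) = monom α y * u y) ∧ (Z i → ∀ y, u y = 0) := by
    intro i
    by_cases hz : Z i
    · exact ⟨0, fun _ => 0, analyticAt_const, fun h => absurd hz h,
        (hφ.tendsto_chart.eventually hz).mono fun y hy => by simp [hy], fun _ _ => rfl⟩
    · obtain ⟨α, u, hu, hu0, hcu⟩ := hnc i hz
      exact ⟨α, u, hu, fun _ => hu0, hcu, fun h => absurd h hz⟩
  choose α u hu hu0 hcu huZ using hex
  have hcomp : ∀ i j, ¬ Z i → ¬ Z j → e i • α i ≤ e j • α j ∨ e j • α j ≤ e i • α i := by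
    intro i j hi hj
    have hrew : ∀ᶠ y in 𝓝 0, monom (e i • α i) y * u i y ^ e i - monom (e j • α j) y * u j y ^ e j
        = c i (φ y) ^ e i - c j (φ y) ^ e j := by
      filter_upwards [hcu i, hcu j] with y h1 h2
      rw [h1, h2, monom_smul, monom_smul, mul_pow, mul_pow]
    refine exponents_comparable ((hu i).pow (e i)).continuousAt ((hu j).pow (e j)).continuousAt
      (pow_ne_zero _ (hu0 i hi)) (pow_ne_zero _ (hu0 j hj)) ?_
    rcases hnd i j with hz | hz
    · exact .inl (by filter_upwards [hz, hrew] with y h1 h2; exact h2.trans h1)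
    · exact .inr (hz.congr hrew)
  obtain ⟨i₀, hi₀, hmin⟩ := (Finset.univ.filter fun i => ¬ Z i).exists_min_image
    (fun i => ∑ k, (e i • α i) k) (by obtain ⟨i, hi⟩ := hne; exact ⟨i, Finset.mem_filter.2 ⟨Finset.mem_univ i, hi⟩⟩)
  replace hi₀ : ¬ Z i₀ := (Finset.mem_filter.1 hi₀).2
  have hdiv : ∀ i, ¬ Z i → e i₀ • α i₀ ≤ e i • α i := by
    intro i hi
    rcases hcomp i₀ i hi₀ hi with hle | hle
    · exact hle
    · have hs := hmin i (Finset.mem_filter.2 ⟨Finset.mem_univ i, hi⟩)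
      have heq := (Finset.sum_eq_sum_iff_of_le fun k _ => hle k).1
        (le_antisymm (Finset.sum_le_sum fun k _ => hle k) hs)
      exact fun k => (heq k (Finset.mem_univ k)).ge
  obtain ⟨ε, σ', hε, hθ⟩ := exists_pow_lift (𝒰.map σ) hφ.map_le hN
  set θ : (ι → ℝ) → ι → ℝ := fun w k => ε k * w k ^ N with hθdef
  set γ := e i₀ • α i₀ with hγ
  have hle : ∀ i, ¬ Z i → (d - i : ℕ) • γ ≤ N • α i := by
    intro i hi
    rw [← he i, mul_comm, mul_smul]
    exact fun k => Nat.mul_le_mul_left _ (hdiv i hi k)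
  refine ⟨fun w => φ (θ w), fun x => σ' (σ x), γ,
    fun i w => monom (α i) ε * (monom (N • α i - (d - i : ℕ) • γ) w * u i (θ w)),
    hφ.comp hθ, ?_, ?_, ?_, ?_, ?_, ?_⟩
  · refine hnh.comp hθ.analyticAt hθ.map_zero fun k => ?_
    exact (IsNormalCrossing.of_unit analyticAt_const (hε k)).mul ((IsNormalCrossing.coord k).pow N)
  · intro h0
    have hα0 : α i₀ = 0 := (smul_eq_zero.1 h0).resolve_left (he0 i₀)
    have := (hcu i₀).self_of_nhds
    rw [hφ.map_zero, hc0, hα0, monom_zero, one_mul] at this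
    exact hu0 i₀ hi₀ this.symm
  · exact fun i => analyticAt_const.mul ((analyticAt_monom _ 0).mul (hθ.comp_analyticAt (hu i)))
  · intro i
    filter_upwards [hθ.tendsto_chart.eventually (hcu i)] with w hw
    by_cases hi : Z i
    · rw [hw, huZ i hi]; ring
    · rw [hw, hθdef, monom_mul_pow, ← monom_smul]
      conv_lhs => rw [← add_tsub_cancel_of_le (hle i hi), monom_add]
      ring
  · intro i hi
    simp [huZ i hi]
  · refine ⟨i₀, ?_⟩
    have : N • α i₀ - (d - i₀ : ℕ) • γ = 0 := by
      rw [hγ, ← mul_smul, mul_comm, he, tsub_self]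
    beta_reduce
    rw [this, monom_zero, one_mul, hθ.map_zero]
    exact mul_ne_zero (monom_ne_zero _ hε) (hu0 i₀ hi₀)

end Lifts

section Dominated

variable {n : ℕ}

/-- Splitting off the first coordinate of `ℝⁿ⁺¹`. -/
noncomputable def splitEquiv (n : ℕ) : (Fin (n + 1) → ℝ) ≃L[ℝ] (Fin n → ℝ) × ℝ :=
  (Fin.consEquivL ℝ fun _ : Fin (n + 1) => ℝ).symm.trans (ContinuousLinearEquiv.prodComm ℝ ℝ _)

@[simp] theorem splitEquiv_fst (y : Fin (n + 1) → ℝ) (k : Fin n) :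
    (splitEquiv n y).1 k = y k.succ := rfl

@[simp] theorem splitEquiv_snd (y : Fin (n + 1) → ℝ) : (splitEquiv n y).2 = y 0 := rfl

theorem exists_tendsto_of_eventually_abs_le {X : Type*} {𝒰 : Ultrafilter X} {f : X → ℝ} {C : ℝ}
    (h : ∀ᶠ x in (𝒰 : Filter X), |f x| ≤ C) : ∃ c, Tendsto f 𝒰 (𝓝 c) := by
  obtain ⟨c, -, hc⟩ := (isCompact_Icc (a := -C) (b := C)).ultrafilter_le_nhds (𝒰.map f)
    (by
      rw [le_principal_iff]
      exact h.mono fun x hx => abs_le.1 hx)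
  exact ⟨c, hc⟩

theorem tendsto_fst_of_le {X : Type*} [NormedAddCommGroup X] {l : Filter (X × ℝ)}
    (h : l ≤ 𝓝 0) : Tendsto Prod.fst l (𝓝 0) :=
  (continuous_fst.tendsto' (0 : X × ℝ) 0 rfl).mono_left h

theorem tendsto_snd_of_le {X : Type*} [NormedAddCommGroup X] {l : Filter (X × ℝ)}
    (h : l ≤ 𝓝 0) : Tendsto Prod.snd l (𝓝 0) :=
  (continuous_snd.tendsto' (0 : X × ℝ) 0 rfl).mono_left h

theorem analyticAt_monom_comp {E : Type*} [NormedAddCommGroup E] [NormedSpace ℝ E] {ι : Type*}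
    [Fintype ι] (γ : ι → ℕ) {φ : E → ι → ℝ} {x : E} (hφ : AnalyticAt ℝ φ x) :
    AnalyticAt ℝ (fun y => monom γ (φ y)) x :=
  (analyticAt_monom γ (φ x)).fun_comp hφ

theorem analyticAt_apply_comp {E : Type*} [NormedAddCommGroup E] [NormedSpace ℝ E] {ι : Type*}
    [Fintype ι] (k : ι) {φ : E → ι → ℝ} {x : E} (hφ : AnalyticAt ℝ φ x) :
    AnalyticAt ℝ (fun y => φ y k) x :=
  (analyticAt_coord k (φ x)).fun_comp hφ

/-- The substitution `t = m(w) (z₀ + z)`, where `z₀` is the limit of `t / m(w)`. -/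
theorem isLift_scale {X : Type*} [NormedAddCommGroup X] [NormedSpace ℝ X] {𝒰 : Ultrafilter (X × ℝ)}
    (h𝒰 : (𝒰 : Filter (X × ℝ)) ≤ 𝓝 0) {m : X → ℝ} (hm : AnalyticAt ℝ m 0) (hm0 : m 0 = 0) {z₀ : ℝ}
    (hz : Tendsto (fun q : X × ℝ => q.2 / m q.1) 𝒰 (𝓝 z₀))
    (hdom : ∀ᶠ q in (𝒰 : Filter (X × ℝ)), m q.1 = 0 → q.2 = 0) :
    IsLift 𝒰 (fun q : X × ℝ => (q.1, m q.1 * (z₀ + q.2))) (fun q => (q.1, q.2 / m q.1 - z₀)) where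
  analyticAt := analyticAt_fst.prod
    ((AnalyticAt.fun_comp (f := Prod.fst) (x := (0 : X × ℝ)) hm analyticAt_fst).mul
      (analyticAt_const.add analyticAt_snd))
  map_zero := by simp [hm0]
  tendsto := by
    rw [← Prod.mk_zero_zero]
    exact (tendsto_fst_of_le h𝒰).prodMk_nhds (by simpa using hz.sub_const z₀)
  eventually_eq := by
    filter_upwards [hdom] with q hq
    by_cases hmq : m q.1 = 0
    · ext <;> simp [hmq, hq hmq]
    · ext
      · rfl
      · simp only [add_sub_cancel]; field_simp

theorem exists_dominated_lift (γ : Fin n → ℕ) : ∀ 𝒰 : Ultrafilter ((Fin n → ℝ) × ℝ),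
    (𝒰 : Filter ((Fin n → ℝ) × ℝ)) ≤ 𝓝 0 →
    (∀ C : ℝ, ∀ᶠ p in (𝒰 : Filter ((Fin n → ℝ) × ℝ)), C * |monom γ p.1| < |p.2|) →
    ∃ (φ : (Fin (n + 1) → ℝ) → (Fin n → ℝ) × ℝ) (σ : (Fin n → ℝ) × ℝ → Fin (n + 1) → ℝ)
      (ρ : (Fin (n + 1) → ℝ) → ℝ), IsLift 𝒰 φ σ ∧ AnalyticAt ℝ ρ 0 ∧
      (∀ᶠ y in 𝓝 0, monom γ (φ y).1 = ρ y * (φ y).2) ∧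
      (∀ k, IsNormalCrossing fun y => (φ y).1 k) ∧ IsNormalCrossing fun y => (φ y).2 := by
  obtain ⟨N, hN⟩ : ∃ N, ∑ k, γ k = N := ⟨_, rfl⟩
  induction N generalizing γ with
  | zero =>
    intro 𝒰 h𝒰 hdom
    have hγ : γ = 0 := by
      ext k; exact (Finset.sum_eq_zero_iff.1 hN) k (Finset.mem_univ k)
    subst hγ
    have h1 : ∀ᶠ p in (𝒰 : Filter ((Fin n → ℝ) × ℝ)), |p.2| < 1 := by
      have := (tendsto_snd_of_le h𝒰).abs
      rw [abs_zero] at this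
      exact this.eventually_lt_const one_pos
    obtain ⟨p, hp, hp'⟩ := ((hdom 1).and h1).exists
    simp at hp
    linarith
  | succ N ih =>
    intro 𝒰 h𝒰 hdom
    obtain ⟨j, hj⟩ : ∃ j, γ j ≠ 0 := by
      by_contra! hall
      simp [hall] at hN
    obtain ⟨β, rfl⟩ := eq_add_single hj
    have hβ : ∑ k, β k = N := by simpa [Finset.sum_add_distrib] using hN
    have hsplit : ∀ w, monom (β + Pi.single j 1) w = w j * monom β w := fun w => by
      rw [monom_add, monom_single, mul_comm]
    have he := fun (𝒱 : Ultrafilter ((Fin n → ℝ) × ℝ)) h => IsLift.of_equiv (𝒰 := 𝒱) h (splitEquiv n)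
    have hcoord := fun k : Fin (n + 1) => IsNormalCrossing.coord k
    have ht0 : ∀ᶠ p in (𝒰 : Filter ((Fin n → ℝ) × ℝ)), p.2 ≠ 0 :=
      (hdom 0).mono fun p hp => by simpa using hp
    rcases 𝒰.eventually_or.1 (Eventually.of_forall fun p : (Fin n → ℝ) × ℝ =>
      le_total |p.2| |p.1 j|) with hle | hle
    · have hw0 : ∀ᶠ p in (𝒰 : Filter ((Fin n → ℝ) × ℝ)), p.1 j ≠ 0 := by
        filter_upwards [hle, ht0] with p h1 h2 h3
        exact h2 (by simpa [h3] using h1)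
      obtain ⟨s₀, hs₀⟩ := exists_tendsto_of_eventually_abs_le (𝒰 := 𝒰)
        (f := fun p => p.2 / p.1 j) (C := 1) (by
          filter_upwards [hle, hw0] with p h1 h2
          rwa [abs_div, div_le_one (abs_pos.2 h2)])
      have hχ := isLift_scale h𝒰 (analyticAt_coord j 0) rfl hs₀ (hw0.mono fun p h h' => absurd h' h)
      by_cases hs : s₀ = 0
      · subst hs
        obtain ⟨φ, σ, ρ, hφ, hρ, hmon, h1, h2⟩ := ih β hβ _ hχ.map_le (by
          intro C
          have : ∀ᶠ p in (𝒰 : Filter ((Fin n → ℝ) × ℝ)), C * |monom β p.1| < |p.2 / p.1 j - 0| := by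
            filter_upwards [hdom C, hw0] with p h1 h2
            rw [hsplit, abs_mul] at h1
            rw [sub_zero, abs_div, lt_div_iff₀ (abs_pos.2 h2)]
            linarith
          exact this)
        refine ⟨_, _, ρ, hχ.comp hφ, hρ, ?_, h1, ?_⟩
        · filter_upwards [hmon] with y hy
          rw [hsplit, hy]; ring
        · simpa using (h1 j).mul h2
      · have he' := he _ hχ.map_le
        have hden : AnalyticAt ℝ (fun y : Fin (n + 1) → ℝ => s₀ + y 0) 0 :=
          analyticAt_const.add (analyticAt_coord 0 0)
        have hden0 : s₀ + (0 : Fin (n + 1) → ℝ) 0 ≠ 0 := by simpa using hs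
        refine ⟨_, _, fun y => monom β (splitEquiv n y).1 / (s₀ + y 0), hχ.comp he',
          (analyticAt_monom_comp β (he'.comp_analyticAt analyticAt_fst)).div hden hden0, ?_,
          fun k => hcoord k.succ, ?_⟩
        · filter_upwards [hden.continuousAt.eventually_ne hden0] with y hy
          rw [hsplit, splitEquiv_snd]
          field_simp
        · exact (hcoord j.succ).mul (IsNormalCrossing.of_unit hden hden0)
    · obtain ⟨r₀, hr₀⟩ := exists_tendsto_of_eventually_abs_le (𝒰 := 𝒰)
        (f := fun p => p.1 j / p.2) (C := 1) (by
          filter_upwards [hle, ht0] with p h1 h2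
          rwa [abs_div, div_le_one (abs_pos.2 h2)])
      have hχ : IsLift 𝒰
          (fun q : (Fin n → ℝ) × ℝ => (fun k => if k = j then (r₀ + q.1 j) * q.2 else q.1 k, q.2))
          (fun q => (fun k => if k = j then q.1 j / q.2 - r₀ else q.1 k, q.2)) := by
        refine ⟨?_, ?_, ?_, ?_⟩
        · refine AnalyticAt.prod (AnalyticAt.pi fun k => ?_) analyticAt_snd
          split_ifs
          · exact (analyticAt_const.add (analyticAt_apply_comp j analyticAt_fst)).mul analyticAt_snd
          · exact analyticAt_apply_comp k analyticAt_fst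
        · ext <;> simp
        · rw [← Prod.mk_zero_zero]
          refine Tendsto.prodMk_nhds (tendsto_pi_nhds.2 fun k => ?_) (tendsto_snd_of_le h𝒰)
          split_ifs
          · simpa using hr₀.sub_const r₀
          · exact tendsto_pi_nhds.1 (tendsto_fst_of_le h𝒰) k
        · filter_upwards [ht0] with q hq
          ext k
          · by_cases hk : k = j
            · subst hk; simp [hq]
            · simp [hk]
          · rfl
      have he' := he _ hχ.map_le
      have hcomp := hχ.comp he'
      have hrj : AnalyticAt ℝ (fun y : Fin (n + 1) → ℝ => r₀ + y j.succ) 0 :=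
        analyticAt_const.add (analyticAt_coord _ 0)
      refine ⟨_, _, fun y => (r₀ + y j.succ) *
        monom β fun k => if k = j then (r₀ + y j.succ) * y 0 else y k.succ, hcomp,
        hrj.mul (analyticAt_monom_comp β (analyticAt_fst.fun_comp hcomp.analyticAt)), ?_, ?_,
        hcoord 0⟩
      · refine Eventually.of_forall fun y => ?_
        rw [hsplit]
        simp only [if_true, splitEquiv_fst, splitEquiv_snd]
        ring
      · intro k
        by_cases hk : k = j
        · subst hk
          simp only [if_true, splitEquiv_fst, splitEquiv_snd]
          by_cases hr : r₀ = 0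
          · simpa [hr] using (hcoord k.succ).mul (hcoord 0)
          · exact (IsNormalCrossing.of_unit hrj (by simpa using hr)).mul (hcoord 0)
        · simpa [hk] using hcoord k.succ

end Dominated

section Order

variable {E : Type*} [NormedAddCommGroup E] [NormedSpace ℝ E]

theorem eventually_line {E : Type*} [NormedAddCommGroup E] {P : E × ℝ → Prop}
    (h : ∀ᶠ p in 𝓝 0, P p) :
    ∀ᶠ s in 𝓝 (0 : ℝ), P (0, s) :=
  ((show Continuous fun s : ℝ => ((0 : E), s) by fun_prop).tendsto' 0 0 rfl).eventually h

theorem dsnd_iterate_line {g : E × ℝ → ℝ} (hg : AnalyticAt ℝ g 0) (k : ℕ) :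
    ∀ᶠ s in 𝓝 (0 : ℝ), dsnd^[k] g (0, s) = deriv^[k] (fun s => g (0, s)) s := by
  induction k with
  | zero => simp
  | succ k ih =>
    filter_upwards [ih.eventually_nhds,
      eventually_line (analyticAt_dsnd_iterate hg k).eventually_analyticAt] with s h1 h2
    rw [Function.iterate_succ_apply', Function.iterate_succ_apply', dsnd_eq_deriv h2]
    exact EventuallyEq.deriv_eq h1

theorem dsnd_shift {g : E × ℝ → ℝ} (hg : AnalyticAt ℝ g 0) {τ : E → ℝ} (hτ : AnalyticAt ℝ τ 0)
    (hτ0 : τ 0 = 0) (k : ℕ) :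
    ∀ᶠ p in 𝓝 (0 : E × ℝ),
      dsnd^[k] (fun p => g (p.1, p.2 + τ p.1)) p = dsnd^[k] g (p.1, p.2 + τ p.1) := by
  have hχ : AnalyticAt ℝ (fun p : E × ℝ => (p.1, p.2 + τ p.1)) 0 :=
    analyticAt_fst.prod (analyticAt_snd.add
      (AnalyticAt.fun_comp (f := Prod.fst) (x := (0 : E × ℝ)) hτ analyticAt_fst))
  have hχt : Tendsto (fun p : E × ℝ => (p.1, p.2 + τ p.1)) (𝓝 0) (𝓝 0) := by
    simpa [hτ0, Prod.zero_eq_mk] using hχ.continuousAt.tendsto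
  have hcomp : ∀ {f : E × ℝ → ℝ}, AnalyticAt ℝ f 0 →
      AnalyticAt ℝ (fun p : E × ℝ => f (p.1, p.2 + τ p.1)) 0 := fun hf =>
    AnalyticAt.fun_comp (by simpa [hτ0, Prod.zero_eq_mk] using hf) hχ
  induction k with
  | zero => simp
  | succ k ih =>
    have hk := analyticAt_dsnd_iterate hg k
    filter_upwards [ih.eventually_nhds, (hcomp hk).eventually_analyticAt,
      hχt.eventually hk.eventually_analyticAt] with p h1 h2 h3
    rw [Function.iterate_succ_apply', Function.iterate_succ_apply', (dsnd_congr h1).eq_of_nhds,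
      dsnd_eq_deriv (y := p.1) (t := p.2) h2, dsnd_eq_deriv h3]
    exact deriv_comp_add_const (f := fun s => dsnd^[k] g (p.1, s)) (τ p.1) p.2

theorem deriv_iterate_polynomial (P : Polynomial ℝ) (z : ℝ) (k : ℕ) :
    deriv^[k] (fun s => P.eval (z + s)) = fun s => (Polynomial.derivative^[k] P).eval (z + s) := by
  induction k with
  | zero => rfl
  | succ k ih =>
    rw [Function.iterate_succ_apply', ih, Function.iterate_succ_apply']
    ext s
    rw [deriv_comp_const_add (f := fun s => (Polynomial.derivative^[k] P).eval s),
      Polynomial.deriv]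

theorem exists_eval_iterate_derivative_ne_zero {P : Polynomial ℝ} {d : ℕ}
    (hd : P.natDegree ≤ d + 1) (hlead : P.coeff (d + 1) ≠ 0) (hnext : P.coeff d = 0)
    (hex : ∃ i < d + 1, P.coeff i ≠ 0) (z : ℝ) :
    ∃ k < d + 1, (Polynomial.derivative^[k] P).eval z ≠ 0 := by
  by_contra! hall
  have hz : z = 0 := by
    have h := hall d (by omega)
    rw [Polynomial.eval_eq_sum_range' (n := 2)] at h
    · simp only [Finset.sum_range_succ, Polynomial.coeff_iterate_derivative] at h
      simp only [Finset.range_zero, Finset.sum_empty, zero_add, hnext, smul_zero, zero_mul,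
        pow_one, add_comm 1 d, nsmul_eq_mul, mul_eq_zero, Nat.cast_eq_zero] at h
      rcases h with (h | h) | h
      · exact absurd (Nat.descFactorial_eq_zero_iff_lt.1 h) (by omega)
      · exact absurd h hlead
      · exact h
    · exact lt_of_le_of_lt (Polynomial.natDegree_iterate_derivative P d) (by omega)
  obtain ⟨i, hi, hPi⟩ := hex
  have h := hall i hi
  rw [hz, ← Polynomial.coeff_zero_eq_eval_zero, Polynomial.coeff_iterate_derivative, zero_add,
    Nat.descFactorial_self, nsmul_eq_mul, mul_eq_zero] at h
  exact h.elim (by exact_mod_cast i.factorial_ne_zero) hPi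

end Order

section Resolution

variable {n : ℕ}

theorem IsNormalCrossing.mul_monom_pow {ι : Type*} [Fintype ι] {H : (ι → ℝ) → ℝ}
    (hH : IsNormalCrossing H) (γ : ι → ℕ) (d : ℕ) :
    IsNormalCrossing fun w => H w * monom γ w ^ d :=
  hH.mul (IsNormalCrossing.pow
    (IsNormalCrossing.prod Finset.univ fun i _ => (IsNormalCrossing.coord i).pow (γ i)) d)

theorem hasResolution_mul_unit (hM : Monomializable (Fin n) (Fin n → ℝ)) {h : (Fin n → ℝ) → ℝ}
    (hh : AnalyticAt ℝ h 0) (hh0 : ¬ ∀ᶠ x in 𝓝 0, h x = 0) (d : ℕ) {u : (Fin n → ℝ) × ℝ → ℝ}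
    (hu : AnalyticAt ℝ u 0) (hu0 : u 0 ≠ 0) (𝒰 : Ultrafilter ((Fin n → ℝ) × ℝ))
    (h𝒰 : (𝒰 : Filter ((Fin n → ℝ) × ℝ)) ≤ 𝓝 0) :
    HasResolution (Fin (n + 1)) 𝒰 fun p => h p.1 * (p.2 ^ d * u p) := by
  obtain ⟨ψ, σ, hψ, hn⟩ := hM h hh hh0 (𝒰.map Prod.fst) (tendsto_fst_of_le h𝒰)
  have hΨ := IsLift.prodMap h𝒰 hψ
  have hφ := hΨ.comp (IsLift.of_equiv hΨ.map_le (splitEquiv n))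
  refine ⟨_, _, hφ, IsNormalCrossing.mul ?_ (IsNormalCrossing.mul ?_ ?_)⟩
  · have hfst : AnalyticAt ℝ (fun y => (splitEquiv n y).1) 0 :=
      analyticAt_fst.fun_comp ((splitEquiv n).toContinuousLinearMap.analyticAt 0)
    exact hn.comp hfst (by simp) fun k => IsNormalCrossing.coord k.succ
  · exact (IsNormalCrossing.coord 0).pow d
  · exact IsNormalCrossing.of_unit (hφ.comp_analyticAt hu) (by rwa [hφ.map_zero])

/-- Germs `h(w) g(w, t)`, with `g` of order `d` in `t`, have resolutions. -/
def ResolvesOrder (n d : ℕ) : Prop :=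
  ∀ (h : (Fin n → ℝ) → ℝ) (g : (Fin n → ℝ) × ℝ → ℝ), AnalyticAt ℝ h 0 →
    (¬ ∀ᶠ x in 𝓝 0, h x = 0) → AnalyticAt ℝ g 0 → (∀ i < d, dsnd^[i] g 0 = 0) →
    dsnd^[d] g 0 ≠ 0 → ∀ 𝒰 : Ultrafilter ((Fin n → ℝ) × ℝ),
    (𝒰 : Filter ((Fin n → ℝ) × ℝ)) ≤ 𝓝 0 →
    HasResolution (Fin (n + 1)) 𝒰 fun p => h p.1 * g p

theorem IsNormalCrossing.analyticAt {ι : Type*} [Fintype ι] {H : (ι → ℝ) → ℝ}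
    (hH : IsNormalCrossing H) : AnalyticAt ℝ H 0 := by
  obtain ⟨α, u, hu, -, h⟩ := hH
  exact ((analyticAt_monom α 0).mul hu).congr (h.mono fun x hx => hx.symm)

theorem hasResolution_of_prepared {d : ℕ} (ih : ∀ k < d + 1, ResolvesOrder n k)
    {H : (Fin n → ℝ) → ℝ} (hH : IsNormalCrossing H) {γ : Fin n → ℕ} (hγ : γ ≠ 0)
    {b : Fin (d + 1) → (Fin n → ℝ) → ℝ} (hb : ∀ i, AnalyticAt ℝ (b i) 0)
    (hlast : b (Fin.last d) 0 = 0) (hex : ∃ i, b i 0 ≠ 0) {v : (Fin n → ℝ) × ℝ → ℝ}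
    (hv : AnalyticAt ℝ v 0) (hv0 : v 0 ≠ 0) (𝒰 : Ultrafilter ((Fin n → ℝ) × ℝ))
    (h𝒰 : (𝒰 : Filter ((Fin n → ℝ) × ℝ)) ≤ 𝓝 0) :
    HasResolution (Fin (n + 1)) 𝒰 fun q => H q.1 *
      (∑ i : Fin (d + 1), monom γ q.1 ^ (d + 1 - i : ℕ) * b i q.1 * q.2 ^ (i : ℕ) +
        q.2 ^ (d + 1) * v q) := by
  by_cases hdom : ∃ C : ℝ, ∀ᶠ q in (𝒰 : Filter ((Fin n → ℝ) × ℝ)), |q.2| ≤ C * |monom γ q.1|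
  · obtain ⟨C, hC⟩ := hdom
    obtain ⟨z₀, hz₀⟩ := exists_tendsto_of_eventually_abs_le (𝒰 := 𝒰)
      (f := fun q => q.2 / monom γ q.1) (C := |C|) (by
        filter_upwards [hC] with q hq
        rw [abs_div]
        refine div_le_of_le_mul₀ (abs_nonneg _) (abs_nonneg _) (hq.trans ?_)
        gcongr
        exact le_abs_self C)
    have hχ := isLift_scale h𝒰 (analyticAt_monom γ 0) (monom_at_zero hγ) hz₀
      (hC.mono fun q hq h0 => by simpa [h0] using hq)
    refine HasResolution.of_lift hχ ?_
    let g : (Fin n → ℝ) × ℝ → ℝ := fun q =>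
      ∑ i : Fin (d + 1), b i q.1 * (z₀ + q.2) ^ (i : ℕ) +
        (z₀ + q.2) ^ (d + 1) * v (q.1, monom γ q.1 * (z₀ + q.2))
    have hz : AnalyticAt ℝ (fun q : (Fin n → ℝ) × ℝ => z₀ + q.2) 0 :=
      analyticAt_const.add analyticAt_snd
    have hg : AnalyticAt ℝ g 0 := by
      refine AnalyticAt.add (Finset.analyticAt_fun_sum _ fun i _ => ?_)
        ((hz.pow _).mul (hχ.comp_analyticAt hv))
      exact (AnalyticAt.fun_comp (f := Prod.fst) (x := (0 : (Fin n → ℝ) × ℝ)) (hb i)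
        analyticAt_fst).mul (hz.pow _)
    have hfac : ∀ q : (Fin n → ℝ) × ℝ, H q.1 *
        (∑ i : Fin (d + 1), monom γ q.1 ^ (d + 1 - i : ℕ) * b i q.1 *
          (monom γ q.1 * (z₀ + q.2)) ^ (i : ℕ) + (monom γ q.1 * (z₀ + q.2)) ^ (d + 1) *
          v (q.1, monom γ q.1 * (z₀ + q.2))) = H q.1 * monom γ q.1 ^ (d + 1) * g q := by
      intro q
      have hi : ∀ i : Fin (d + 1), monom γ q.1 ^ (d + 1 - i : ℕ) * b i q.1 *
          (monom γ q.1 * (z₀ + q.2)) ^ (i : ℕ) =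
          monom γ q.1 ^ (d + 1) * (b i q.1 * (z₀ + q.2) ^ (i : ℕ)) := by
        intro i
        have : monom γ q.1 ^ (d + 1) = monom γ q.1 ^ (d + 1 - i : ℕ) * monom γ q.1 ^ (i : ℕ) := by
          rw [← pow_add]; congr 1; omega
        rw [this, mul_pow]; ring
      rw [Finset.sum_congr rfl fun i _ => hi i, ← Finset.mul_sum, mul_pow]
      simp only [g]
      ring
    let P : Polynomial ℝ := ∑ i : Fin (d + 1), Polynomial.monomial (i : ℕ) (b i 0) +
      Polynomial.monomial (d + 1) (v 0)
    have hcoeff : ∀ i : Fin (d + 1), P.coeff i = b i 0 := by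
      intro i
      have hne : d + 1 ≠ (i : ℕ) := by omega
      simp [P, Polynomial.coeff_monomial, hne, Fin.val_inj]
    have hlead : P.coeff (d + 1) = v 0 := by
      have hne : ∀ i : Fin (d + 1), (i : ℕ) ≠ d + 1 := fun i => by omega
      simp [P, Polynomial.coeff_monomial, hne]
    have hdeg : P.natDegree ≤ d + 1 := by
      refine Polynomial.natDegree_add_le_of_degree_le
        (Polynomial.natDegree_sum_le_of_forall_le _ _ fun i _ => ?_)
        (Polynomial.natDegree_monomial_le _)
      exact (Polynomial.natDegree_monomial_le _).trans (by omega)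
    have hline : (fun s => g (0, s)) = fun s => P.eval (z₀ + s) := by
      ext s
      simp only [g, P, monom_at_zero hγ, zero_mul, Polynomial.eval_add, Polynomial.eval_finsetSum,
        Polynomial.eval_monomial, ← Prod.zero_eq_mk]
      ring
    have hex' : ∃ k < d + 1, dsnd^[k] g 0 ≠ 0 := by
      obtain ⟨i, hi⟩ := hex
      obtain ⟨k, hk, hne⟩ := exists_eval_iterate_derivative_ne_zero hdeg (by rwa [hlead])
        (by simpa using (hcoeff (Fin.last d)).trans hlast) ⟨i, i.2, by rwa [hcoeff]⟩ z₀
      refine ⟨k, hk, ?_⟩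
      have := (dsnd_iterate_line hg k).self_of_nhds
      rw [hline, deriv_iterate_polynomial] at this
      rw [← Prod.mk_zero_zero, this]
      simpa using hne
    classical
    have hk := Nat.find_spec hex'
    have hmin : ∀ i < Nat.find hex', dsnd^[i] g 0 = 0 := fun i hi => by
      by_contra hne
      exact Nat.find_min hex' hi ⟨hi.trans hk.1, hne⟩
    have hHm := hH.mul_monom_pow γ (d + 1)
    refine HasResolution.congr (ih _ hk.1 _ g hHm.analyticAt hHm.not_eventually_eq_zero hg
      hmin hk.2 _ hχ.map_le) (Eventually.of_forall hfac)
  · push Not at hdom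
    obtain ⟨φ, σ, ρ, hφ, hρ, hmon, h1, h2⟩ := exists_dominated_lift γ 𝒰 h𝒰 hdom
    have hρ0 : ρ 0 = 0 := by
      by_contra hne
      have habs : |ρ 0| / 2 < |ρ 0| := half_lt_self (abs_pos.2 hne)
      have hlim := (hρ.continuousAt.tendsto.comp hφ.tendsto).abs.eventually_const_lt habs
      obtain ⟨q, hq1, hq2, hq3, hq4⟩ := (hlim.and ((hdom (2 / |ρ 0|)).and
        ((hφ.tendsto.eventually hmon).and hφ.eventually_eq))).exists
      rw [hq4] at hq3
      rw [hq3, abs_mul] at hq2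
      simp only [Function.comp] at hq1
      have hpos : 0 < |ρ 0| := abs_pos.2 hne
      have : 1 * |q.2| ≤ 2 / |ρ 0| * |ρ (σ q)| * |q.2| := by
        gcongr
        rw [div_mul_eq_mul_div, le_div_iff₀ hpos]
        linarith
      linarith
    have hfst : AnalyticAt ℝ (fun y => (φ y).1) 0 := analyticAt_fst.fun_comp hφ.analyticAt
    have hfst0 : (φ 0).1 = 0 := by rw [hφ.map_zero, Prod.fst_zero]
    refine ⟨φ, σ, hφ, IsNormalCrossing.congr (f := fun y => H (φ y).1 * ((φ y).2 ^ (d + 1) *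
      (∑ i : Fin (d + 1), ρ y ^ (d + 1 - i : ℕ) * b i (φ y).1 + v (φ y)))) ?_ ?_⟩
    · refine (hH.comp hfst hfst0 h1).mul ((h2.pow _).mul (IsNormalCrossing.of_unit ?_ ?_))
      · refine (Finset.analyticAt_fun_sum _ fun i _ => (hρ.pow _).mul ?_).add
          (hφ.comp_analyticAt hv)
        exact AnalyticAt.fun_comp (by rw [hfst0]; exact hb i) hfst
      · have hne : ∀ i : Fin (d + 1), d + 1 - (i : ℕ) ≠ 0 := fun i => by omega
        simpa [hρ0, hne, hφ.map_zero] using hv0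
    · filter_upwards [hmon] with y hy
      rw [mul_add ((φ y).2 ^ (d + 1)), Finset.mul_sum, hy]
      congr 2
      refine Finset.sum_congr rfl fun i _ => ?_
      have : (φ y).2 ^ (d + 1) = (φ y).2 ^ (d + 1 - i : ℕ) * (φ y).2 ^ (i : ℕ) := by
        rw [← pow_add]; congr 1; omega
      rw [this, mul_pow]; ring

theorem resolvesOrder (hM : Monomializable (Fin n) (Fin n → ℝ)) (d : ℕ) : ResolvesOrder n d := by
  induction d using Nat.strong_induction_on with
  | _ d ih =>
    intro h g hh hh0 hg hvan hne 𝒰 h𝒰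
    obtain rfl | ⟨d, rfl⟩ : d = 0 ∨ ∃ k, d = k + 1 := by cases d <;> simp
    · simpa using hasResolution_mul_unit hM hh hh0 0 hg hne 𝒰 h𝒰
    obtain ⟨τ, hτ, hτ0, hτv⟩ := exists_implicit (analyticAt_dsnd_iterate hg d) (hvan d (by omega))
      (by rwa [← Function.iterate_succ_apply' dsnd d g])
    have hτ' : AnalyticAt ℝ (fun p : (Fin n → ℝ) × ℝ => τ p.1) 0 :=
      AnalyticAt.fun_comp (f := Prod.fst) (x := (0 : (Fin n → ℝ) × ℝ)) hτ analyticAt_fst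
    have hχ : IsLift 𝒰 (fun p : (Fin n → ℝ) × ℝ => (p.1, p.2 + τ p.1))
        (fun p => (p.1, p.2 - τ p.1)) := by
      refine ⟨analyticAt_fst.prod (analyticAt_snd.add hτ'), by simp [hτ0], ?_, by simp⟩
      have := (continuousAt_fst.prodMk (continuousAt_snd.sub hτ'.continuousAt)).tendsto.mono_left h𝒰
      simpa [hτ0, Prod.zero_eq_mk] using this
    refine HasResolution.of_lift hχ ?_
    set 𝒱 := 𝒰.map fun p => (p.1, p.2 - τ p.1)
    have h𝒱 : (𝒱 : Filter ((Fin n → ℝ) × ℝ)) ≤ 𝓝 0 := hχ.map_le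
    let g' : (Fin n → ℝ) × ℝ → ℝ := fun p => g (p.1, p.2 + τ p.1)
    have hg' : AnalyticAt ℝ g' 0 := hχ.comp_analyticAt hg
    have hshift : ∀ k, dsnd^[k] g' 0 = dsnd^[k] g 0 := fun k => by
      simpa [hτ0, Prod.zero_eq_mk] using (dsnd_shift hg hτ hτ0 k).self_of_nhds
    obtain ⟨u, hu, hu0, htaylor⟩ := exists_taylor hg' (d + 1)
    have hu0' : u 0 ≠ 0 := by
      rw [hu0, hshift]
      exact div_ne_zero hne (by exact_mod_cast (d + 1).factorial_ne_zero)
    have hincl : AnalyticAt ℝ (fun w : Fin n → ℝ => (w, (0 : ℝ))) 0 :=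
      analyticAt_id.prod analyticAt_const
    let c : Fin (d + 1) → (Fin n → ℝ) → ℝ := fun i w => dsnd^[i] g' (w, 0) / (i : ℕ).factorial
    have hc : ∀ i, AnalyticAt ℝ (c i) 0 := fun i =>
      ((analyticAt_dsnd_iterate hg' i).fun_comp (f := fun w : Fin n → ℝ => (w, (0 : ℝ)))
        hincl).div_const
    have hc0 : ∀ i, c i 0 = 0 := fun i => by
      simp only [c]
      rw [Prod.mk_zero_zero, hshift, hvan i i.2, zero_div]
    have hlast : ∀ᶠ w in 𝓝 0, c (Fin.last d) w = 0 := by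
      have h1 : Tendsto (fun w : Fin n → ℝ => (w, (0 : ℝ))) (𝓝 0) (𝓝 0) :=
        hincl.continuousAt.tendsto
      filter_upwards [h1.eventually (dsnd_shift hg hτ hτ0 d), hτv] with w h2 h3
      simp only [c, Fin.val_last, g', h2, zero_add, h3, zero_div]
    have hexp : ∀ᶠ p in 𝓝 0, h p.1 * g' p =
        h p.1 * (∑ i, c i p.1 * p.2 ^ (i : ℕ) + p.2 ^ (d + 1) * u p) := by
      filter_upwards [htaylor] with p hp
      rw [hp, Finset.sum_range]
    refine HasResolution.congr ?_ hexp
    by_cases hall : ∀ i, ∀ᶠ w in 𝓝 0, c i w = 0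
    · refine (hasResolution_mul_unit hM hh hh0 (d + 1) hu hu0' 𝒱 h𝒱).congr ?_
      filter_upwards [(continuous_fst.tendsto' (0 : (Fin n → ℝ) × ℝ) 0 rfl).eventually
        (eventually_all.2 hall)] with p hp
      simp [hp]
    · obtain ⟨ψ, σ, γ, b, hψ, hH, hγ, hb, hcb, hzero, hex⟩ := hM.exists_prepared hh hh0 hc hc0
        (not_forall.1 hall) (𝒱.map Prod.fst) (tendsto_fst_of_le h𝒱)
      have hΨ := IsLift.prodMap h𝒱 hψ
      refine HasResolution.of_lift hΨ ((hasResolution_of_prepared ih hH hγ hb (hzero _ hlast) hex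
        (hΨ.comp_analyticAt hu) (by rwa [hΨ.map_zero]) _ hΨ.map_le).congr ?_)
      filter_upwards [(continuous_fst.tendsto' (0 : (Fin n → ℝ) × ℝ) 0 rfl).eventually
        (eventually_all.2 hcb)] with p hp
      simp only [hp]

theorem exists_line_not_eventually_eq_zero {E : Type*} [NormedAddCommGroup E] [NormedSpace ℝ E]
    [Nontrivial E] {g : E → ℝ} (hg : AnalyticAt ℝ g 0) (hne : ¬ ∀ᶠ x in 𝓝 0, g x = 0) :
    ∃ v : E, v ≠ 0 ∧ ¬ ∀ᶠ s in 𝓝 (0 : ℝ), g (s • v) = 0 := by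
  by_contra! hall
  obtain ⟨r, hr, hball⟩ := Metric.eventually_nhds_iff_ball.1 hg.eventually_analyticAt
  refine hne (Metric.eventually_nhds_iff_ball.2 ⟨r, hr, fun x hx => ?_⟩)
  by_cases hx0 : x = 0
  · obtain ⟨v, hv⟩ := exists_ne (0 : E)
    simpa [hx0] using (hall v hv).self_of_nhds
  · let U : Set ℝ := (fun s : ℝ => s • x) ⁻¹' Metric.ball 0 r
    have hU : IsPreconnected U :=
      ((convex_ball (0 : E) r).linear_preimage (LinearMap.toSpanSingleton ℝ E x)).isPreconnected
    have han : AnalyticOnNhd ℝ (fun s : ℝ => g (s • x)) U := fun s hs =>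
      AnalyticAt.fun_comp (f := fun s : ℝ => s • x) (hball _ hs)
        (analyticAt_id.smul analyticAt_const)
    have h1 := han.eqOn_zero_of_preconnected_of_eventuallyEq_zero hU
      (show (0 : ℝ) ∈ U by simp [U, hr]) (hall x hx0)
    simpa using h1 (show (1 : ℝ) ∈ U by simpa [U] using hx)

theorem exists_dsnd_iterate_ne_zero {E : Type*} [NormedAddCommGroup E] [NormedSpace ℝ E]
    {g : E × ℝ → ℝ} (hg : AnalyticAt ℝ g 0) (hne : ¬ ∀ᶠ s in 𝓝 (0 : ℝ), g (0, s) = 0) :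
    ∃ k, dsnd^[k] g 0 ≠ 0 := by
  by_contra! hall
  have han : AnalyticAt ℝ (fun s : ℝ => g (0, s)) 0 :=
    AnalyticAt.fun_comp (f := fun s : ℝ => ((0 : E), s)) (x := 0) hg
      (analyticAt_const.prod analyticAt_id)
  refine hne (analyticOrderAt_eq_top.1 (ENat.eq_top_iff_forall_ge.2 fun m => ?_))
  refine (natCast_le_analyticOrderAt_iff_iteratedDeriv_eq_zero han).2 fun i _ => ?_
  rw [iteratedDeriv_eq_iterate, ← (dsnd_iterate_line hg i).self_of_nhds]
  exact hall i

theorem monomializable (n : ℕ) : Monomializable (Fin n) (Fin n → ℝ) := by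
  induction n with
  | zero =>
    intro g hg hne 𝒰 h𝒰
    refine ⟨_, _, IsLift.of_equiv h𝒰 (ContinuousLinearEquiv.refl ℝ _),
      IsNormalCrossing.of_unit hg fun h0 => hne ?_⟩
    exact Eventually.of_forall fun x => by rw [Subsingleton.elim x 0]; exact h0
  | succ n ih =>
    intro g hg hne 𝒰 h𝒰
    obtain ⟨v, hv, hline⟩ := exists_line_not_eventually_eq_zero hg hne
    let e := (splitEquiv n).symm
    obtain ⟨A, hA⟩ := SeparatingDual.exists_continuousLinearEquiv_apply_eq (R := ℝ)
      (x := e (0, 1)) (y := v) (by simp) hv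
    let L := e.trans A
    have hL : ∀ s : ℝ, L (0, s) = s • v := fun s => by
      rw [← hA, ← map_smul, ← map_smul]
      simp [L]
    have hlift := IsLift.of_equiv h𝒰 L
    have hgL := hlift.comp_analyticAt hg
    have hex := exists_dsnd_iterate_ne_zero hgL (by simpa only [hL] using hline)
    classical
    refine HasResolution.of_lift hlift ?_
    simpa using resolvesOrder ih (Nat.find hex) (fun _ => 1) _ analyticAt_const
      (fun h => one_ne_zero h.self_of_nhds) hgL
      (fun i hi => not_not.1 (Nat.find_min hex hi)) (Nat.find_spec hex) _ hlift.map_le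

end Resolution

section Gradient

theorem IsNormalCrossing.pow_le_fderiv {ι : Type*} [Fintype ι] {G : (ι → ℝ) → ℝ}
    (hG : IsNormalCrossing G) (h0 : G 0 = 0) :
    ∃ (m : ℕ) (C : ℝ), 0 ≤ C ∧
      ∀ᶠ y in 𝓝 0, |G y| ^ (m + 1) ≤ C * ‖fderiv ℝ G y‖ ^ (m + 1) * |G y| := by
  classical
  obtain ⟨α, u, hu, hu0, hGu⟩ := hG
  have hα : α ≠ 0 := by
    rintro rfl
    have := hGu.self_of_nhds
    rw [h0, monom_zero, one_mul] at this
    exact hu0 this.symm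
  obtain ⟨j, hj⟩ := Function.ne_iff.1 hα
  obtain ⟨m, hm⟩ : ∃ m, ∑ i, α i = m + 1 := Nat.exists_eq_succ_of_ne_zero fun h =>
    hj ((Finset.sum_eq_zero_iff.1 h) j (Finset.mem_univ j))
  have hpos : 0 < |u 0| := abs_pos.2 hu0
  have hlow : ∀ᶠ y in 𝓝 0, |u 0| / 2 < |u y| :=
    hu.continuousAt.abs.eventually_const_lt (half_lt_self hpos)
  have hdir : ∀ k : ι, Continuous fun y : ι → ℝ => y k • (Pi.single k 1 : ι → ℝ) := fun k => by
    fun_prop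
  have hdu : ∀ k, ContinuousAt (fun y => fderiv ℝ u y (y k • (Pi.single k 1 : ι → ℝ))) 0 := fun k =>
    hu.fderiv.continuousAt.clm_apply (hdir k).continuousAt
  have hfac : ∀ k, α k ≠ 0 → ∀ᶠ y in 𝓝 0,
      |u y| / 2 < |α k * u y + fderiv ℝ u y (y k • (Pi.single k 1 : ι → ℝ))| := by
    intro k hk
    refine (hu.continuousAt.abs.div_const 2).eventually_lt
      ((continuousAt_const.mul hu.continuousAt).add (hdu k)).abs ?_
    have h1 : (1 : ℝ) ≤ α k := by exact_mod_cast Nat.one_le_iff_ne_zero.2 hk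
    simp only [Pi.zero_apply, zero_smul, map_zero, add_zero, abs_mul, Nat.abs_cast]
    nlinarith
  have hder : ∀ k, ∀ᶠ y in 𝓝 0, fderiv ℝ G y (y k • (Pi.single k 1 : ι → ℝ)) =
      monom α y * (α k * u y + fderiv ℝ u y (y k • (Pi.single k 1 : ι → ℝ))) := by
    intro k
    have hGa : AnalyticAt ℝ G 0 :=
      ((analyticAt_monom α 0).mul hu).congr (hGu.mono fun x hx => hx.symm)
    filter_upwards [hGu.eventually_nhds, hu.eventually_analyticAt, hGa.eventually_analyticAt]
      with y hy huy hGy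
    set v : ι → ℝ := y k • Pi.single k 1 with hv
    have hline : HasDerivAt (fun s : ℝ => y + s • v) v 0 := by
      simpa using ((hasDerivAt_id (0 : ℝ)).smul_const v).const_add y
    have hcurve : ∀ {F : (ι → ℝ) → ℝ}, AnalyticAt ℝ F y →
        HasDerivAt (fun s : ℝ => F (y + s • v)) (fderiv ℝ F y v) 0 := fun {F} hF =>
      HasFDerivAt.comp_hasDerivAt (x := (0 : ℝ)) (f := fun s : ℝ => y + s • v) (l := F)
        (by simpa using hF.differentiableAt.hasFDerivAt) hline
    have hmon : ∀ s : ℝ, monom α (y + s • v) = (1 + s) ^ α k * monom α y := by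
      intro s
      rw [monom, monom, ← Finset.mul_prod_erase _ _ (Finset.mem_univ k),
        ← Finset.mul_prod_erase _ (fun i => y i ^ α i) (Finset.mem_univ k), ← mul_assoc, ← mul_pow]
      congr 1
      · simp [hv]; ring
      · refine Finset.prod_congr rfl fun i hi => ?_
        simp [hv, Finset.ne_of_mem_erase hi]
    have hpow : HasDerivAt (fun s : ℝ => (1 + s) ^ α k) (α k) 0 := by
      simpa using ((hasDerivAt_id (0 : ℝ)).const_add 1).fun_pow (α k)
    have hprod := (hpow.mul_const (monom α y)).mul (hcurve huy)
    refine (hcurve hGy).unique ((hprod.congr_of_eventuallyEq ?_).congr_deriv ?_)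
    · have ht : Tendsto (fun s : ℝ => y + s • v) (𝓝 0) (𝓝 y) := by
        simpa using hline.continuousAt.tendsto
      filter_upwards [ht.eventually hy] with s hs
      rw [hs, hmon]; rfl
    · simp; ring
  refine ⟨m, 2 ^ (m + 1) * (2 / |u 0|), by positivity, ?_⟩
  have hfac' : ∀ᶠ y in 𝓝 (0 : ι → ℝ), ∀ k, α k ≠ 0 →
      |u y| / 2 < |α k * u y + fderiv ℝ u y (y k • (Pi.single k 1 : ι → ℝ))| :=
    eventually_all.2 fun k => by
      by_cases hk : α k = 0
      · simp [hk]
      · exact (hfac k hk).mono fun y hy _ => hy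
  filter_upwards [hGu, hlow, hfac', eventually_all.2 hder] with y hy hlow hfac hder
  obtain ⟨k, hk, hmin⟩ := (Finset.univ.filter fun i => α i ≠ 0).exists_min_image (fun i => |y i|)
    ⟨j, Finset.mem_filter.2 ⟨Finset.mem_univ j, hj⟩⟩
  replace hk := (Finset.mem_filter.1 hk).2
  have hyk : |y k| ^ (m + 1) ≤ |monom α y| := by
    rw [← hm, ← Finset.prod_pow_eq_pow_sum, monom, Finset.abs_prod]
    refine Finset.prod_le_prod (fun i _ => by positivity) fun i _ => ?_
    rw [abs_pow]
    by_cases hi : α i = 0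
    · simp [hi]
    · exact pow_le_pow_left₀ (abs_nonneg _)
        (hmin i (Finset.mem_filter.2 ⟨Finset.mem_univ i, hi⟩)) _
  have hGk : |G y| ≤ 2 * (‖fderiv ℝ G y‖ * |y k|) := by
    have h1 : |fderiv ℝ G y (y k • (Pi.single k 1 : ι → ℝ))| ≤ ‖fderiv ℝ G y‖ * |y k| := by
      refine ((fderiv ℝ G y).le_opNorm _).trans_eq ?_
      rw [norm_smul, Pi.norm_single, norm_one, mul_one, Real.norm_eq_abs]
    rw [hder k, abs_mul] at h1
    have h2 := mul_le_mul_of_nonneg_left (hfac k hk).le (abs_nonneg (monom α y))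
    rw [hy, abs_mul]
    linarith
  have hmonG : |monom α y| ≤ 2 / |u 0| * |G y| := by
    rw [hy, abs_mul, div_mul_eq_mul_div, le_div_iff₀ hpos]
    nlinarith [abs_nonneg (monom α y)]
  calc |G y| ^ (m + 1) ≤ (2 * (‖fderiv ℝ G y‖ * |y k|)) ^ (m + 1) := by gcongr
    _ = 2 ^ (m + 1) * ‖fderiv ℝ G y‖ ^ (m + 1) * |y k| ^ (m + 1) := by ring
    _ ≤ 2 ^ (m + 1) * ‖fderiv ℝ G y‖ ^ (m + 1) * (2 / |u 0| * |G y|) := by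
      gcongr
      exact hyk.trans hmonG
    _ = _ := by ring

theorem exists_uniform_exponent {E : Type*} [PseudoMetricSpace E] {f N : E → ℝ} {a : E}
    (hf : ContinuousAt f a) (h0 : f a = 0) (hN : ∀ x, 0 ≤ N x)
    (h : ∀ 𝒰 : Ultrafilter E, (𝒰 : Filter E) ≤ 𝓝 a → ∃ (m : ℕ) (C : ℝ),
      ∀ᶠ x in (𝒰 : Filter E), f x ≠ 0 → |f x| ^ (m / (m + 1) : ℝ) ≤ C * N x) :
    ∃ (m : ℕ) (C : ℝ), ∀ᶠ x in 𝓝 a, f x ≠ 0 → |f x| ^ (m / (m + 1) : ℝ) ≤ C * N x := by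
  by_contra! H
  have hseq : ∀ k : ℕ, ∃ x, dist x a < 1 / (k + 1 : ℝ) ∧ f x ≠ 0 ∧
      k * N x < |f x| ^ (k / (k + 1) : ℝ) := fun k => by
    obtain ⟨x, hx, hx'⟩ := ((H k k).and_eventually
      (Metric.ball_mem_nhds a (Nat.one_div_pos_of_nat (n := k) (α := ℝ)))).exists
    exact ⟨x, hx', hx⟩
  choose x hx hx0 hxN using hseq
  have hlim : Tendsto x atTop (𝓝 a) := tendsto_iff_dist_tendsto_zero.2
    (squeeze_zero (fun _ => dist_nonneg) (fun k => (hx k).le) tendsto_one_div_add_atTop_nhds_zero_nat)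
  have hhyp : ((hyperfilter ℕ : Ultrafilter ℕ) : Filter ℕ) ≤ atTop := by
    rw [← Nat.cofinite_eq_atTop]
    exact hyperfilter_le_cofinite
  obtain ⟨m, C, hmC⟩ := h ((hyperfilter ℕ).map x) (hlim.mono_left hhyp)
  have hmC' : ∀ᶠ k in ((hyperfilter ℕ : Ultrafilter ℕ) : Filter ℕ),
    f (x k) ≠ 0 → |f (x k)| ^ (m / (m + 1) : ℝ) ≤ C * N (x k) := hmC
  have hsmall : ∀ᶠ y in 𝓝 a, |f y| < 1 :=
    hf.abs.eventually_lt_const (by simp [h0])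
  obtain ⟨k, h1, h2, h3, h4⟩ := (hmC'.and (hhyp ((hlim.eventually hsmall).and
    ((eventually_ge_atTop m).and (tendsto_natCast_atTop_atTop.eventually_ge_atTop C))))).exists
  have hle : |f (x k)| ^ (k / (k + 1) : ℝ) ≤ |f (x k)| ^ (m / (m + 1) : ℝ) := by
    refine Real.rpow_le_rpow_of_exponent_ge (abs_pos.2 (hx0 k)) h2.le ?_
    have : (m : ℝ) ≤ k := by exact_mod_cast h3
    rw [div_le_div_iff₀ (by positivity) (by positivity)]
    linarith
  have := mul_le_mul_of_nonneg_right h4 (hN (x k))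
  linarith [h1 (hx0 k), hxN k]

/-- The Łojasiewicz gradient inequality. -/
theorem lojasiewicz_gradient {E : Type*} [NormedAddCommGroup E] [NormedSpace ℝ E]
    [FiniteDimensional ℝ E] {f : E → ℝ} {a : E} (hf : AnalyticAt ℝ f a) :
    ∃ (m : ℕ) (C : ℝ), ∀ᶠ x in 𝓝 a, f x - f a ≠ 0 →
      |f x - f a| ^ (m / (m + 1) : ℝ) ≤ C * ‖fderiv ℝ f x‖ := by
  refine exists_uniform_exponent (hf.continuousAt.sub_const (f a)) (sub_self _)
    (fun _ => norm_nonneg _) fun 𝒰 h𝒰 => ?_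
  let n := Module.finrank ℝ E
  let L : (Fin n → ℝ) ≃L[ℝ] E := ContinuousLinearEquiv.ofFinrankEq (by simp [n])
  have hLa : AnalyticAt ℝ (fun w => a + L w) 0 :=
    analyticAt_const.add (L.toContinuousLinearMap.analyticAt 0)
  have hg : AnalyticAt ℝ (fun w => f (a + L w) - f a) 0 :=
    (AnalyticAt.fun_comp (by simpa using hf) hLa).sub analyticAt_const
  have hlim : Tendsto (fun x => L.symm (x - a)) 𝒰 (𝓝 0) :=
    Tendsto.mono_left (Continuous.tendsto' (by fun_prop) _ _ (by simp)) h𝒰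
  by_cases hz : ∀ᶠ w in 𝓝 0, f (a + L w) - f a = 0
  · exact ⟨0, 0, (hlim.eventually hz).mono fun x hx hne => absurd (by simpa using hx) hne⟩
  obtain ⟨φ, σ, hφ, hn⟩ := monomializable n _ hg hz (𝒰.map fun x => L.symm (x - a)) hlim
  have hΦ : AnalyticAt ℝ (fun y => a + L (φ y)) 0 := hφ.comp_analyticAt hLa
  have hΦ0 : a + L (φ 0) = a := by simp [hφ.map_zero]
  obtain ⟨m, C, hC, hmC⟩ := hn.pow_le_fderiv (by simp [hφ.map_zero])
  have hM := hΦ.fderiv.continuousAt.norm.eventually_lt_const (lt_add_one _)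
  set M := ‖fderiv ℝ (fun y => a + L (φ y)) 0‖ + 1
  have hM0 : 0 ≤ M := by positivity
  have hchart : ∀ᶠ y in 𝓝 0, f (a + L (φ y)) - f a ≠ 0 →
      |f (a + L (φ y)) - f a| ^ (m / (m + 1) : ℝ) ≤
        C ^ (1 / (m + 1) : ℝ) * M * ‖fderiv ℝ f (a + L (φ y))‖ := by
    have hΦt : Tendsto (fun y => a + L (φ y)) (𝓝 0) (𝓝 a) := by
      simpa only [hΦ0] using hΦ.continuousAt.tendsto
    filter_upwards [hmC, hM, hΦ.eventually_analyticAt, hΦt.eventually hf.eventually_analyticAt]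
      with y h1 h2 h3 h4 hne
    have hchain : fderiv ℝ (fun y => f (a + L (φ y)) - f a) y =
        (fderiv ℝ f (a + L (φ y))).comp (fderiv ℝ (fun y => a + L (φ y)) y) := by
      rw [fderiv_sub_const]
      exact fderiv_comp (g := f) y h4.differentiableAt h3.differentiableAt
    have hnorm : ‖fderiv ℝ (fun y => f (a + L (φ y)) - f a) y‖ ≤
        M * ‖fderiv ℝ f (a + L (φ y))‖ := by
      rw [hchain, mul_comm]
      exact (ContinuousLinearMap.opNorm_comp_le _ _).trans (by gcongr)
    have hpos := abs_pos.2 hne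
    have h5 : |f (a + L (φ y)) - f a| ^ m ≤ C * (M * ‖fderiv ℝ f (a + L (φ y))‖) ^ (m + 1) := by
      refine le_of_mul_le_mul_right ?_ hpos
      rw [← pow_succ]
      refine h1.trans ?_
      gcongr
    have h6 := Real.rpow_le_rpow (by positivity) h5 (show (0 : ℝ) ≤ 1 / (m + 1) by positivity)
    rw [Real.mul_rpow hC (by positivity), ← Real.rpow_natCast, ← Real.rpow_natCast,
      ← Real.rpow_mul (abs_nonneg _), ← Real.rpow_mul (by positivity)] at h6
    rw [mul_one_div, Nat.cast_succ, mul_one_div_cancel (by positivity), Real.rpow_one] at h6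
    linarith
  refine ⟨m, C ^ (1 / (m + 1) : ℝ) * M, ?_⟩
  have heq : ∀ᶠ x in (𝒰 : Filter E), φ (σ (L.symm (x - a))) = L.symm (x - a) := hφ.eventually_eq
  have hσ : Tendsto (fun x => σ (L.symm (x - a))) 𝒰 (𝓝 0) := hφ.tendsto
  filter_upwards [heq, hσ.eventually hchart] with x h1 h2
  rw [h1, L.apply_symm_apply, add_sub_cancel] at h2
  exact h2

end Gradient

end AnalyticGerm

namespace GradientFlow

theorem frequently_of_mem_omega {E : Type*} [TopologicalSpace E] {x : ℝ → E} {p : E}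
    (hp : p ∈ ⋂ T : ℝ, closure (x '' Set.Ici T)) {P : E → Prop}
    (hP : ∀ᶠ y in 𝓝 p, P y) : ∃ᶠ t in atTop, P (x t) := by
  refine frequently_atTop.2 fun T => ?_
  obtain ⟨_, hy, t, ht, rfl⟩ := mem_closure_iff_nhds.1 (Set.mem_iInter.1 hp T) _ hP
  exact ⟨t, ht, hy⟩

theorem eq_of_mem_omega_of_tendsto {E : Type*} [TopologicalSpace E] [T2Space E] {x : ℝ → E}
    {p q : E} (hq : q ∈ ⋂ T : ℝ, closure (x '' Set.Ici T))
    (h : Tendsto x atTop (𝓝 p)) : q = p := by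
  by_contra hne
  obtain ⟨U, V, hU, hV, hqU, hpV, hUV⟩ := t2_separation hne
  obtain ⟨t, htU, htV⟩ := ((frequently_of_mem_omega hq (hU.mem_nhds hqU)).and_eventually
    (h.eventually (hV.mem_nhds hpV))).exists
  exact Set.disjoint_left.1 hUV htU htV

section

variable {E : Type*} [NormedAddCommGroup E] [InnerProductSpace ℝ E] [FiniteDimensional ℝ E]
  {f : E → ℝ} {x : ℝ → E} {p : E}

theorem norm_gradient_eq (f : E → ℝ) (y : E) : ‖gradient f y‖ = ‖fderiv ℝ f y‖ := by
  simp [gradient]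

theorem continuous_gradient (hf : ∀ p, AnalyticAt ℝ f p) : Continuous (gradient f) :=
  (InnerProductSpace.toDual ℝ E).symm.continuous.comp
    (continuous_iff_continuousAt.2 fun p => (hf p).fderiv.continuousAt)

theorem hasDerivAt_comp (hf : ∀ p, AnalyticAt ℝ f p)
    (hx : ∀ t : ℝ, 0 ≤ t → HasDerivAt x (gradient f (x t)) t) {t : ℝ} (ht : 0 ≤ t) :
    HasDerivAt (fun t => f (x t)) (‖gradient f (x t)‖ ^ 2) t := by
  have h := (hf (x t)).differentiableAt.hasGradientAt.hasFDerivAt.comp_hasDerivAt t (hx t ht)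
  refine h.congr_deriv ?_
  rw [InnerProductSpace.toDual_apply_apply, real_inner_self_eq_norm_sq]

theorem monotoneOn_comp (hf : ∀ p, AnalyticAt ℝ f p)
    (hx : ∀ t : ℝ, 0 ≤ t → HasDerivAt x (gradient f (x t)) t) :
    MonotoneOn (fun t => f (x t)) (Set.Ici 0) := by
  refine monotoneOn_of_hasDerivWithinAt_nonneg (convex_Ici 0)
    (fun t ht => (hasDerivAt_comp hf hx ht).continuousAt.continuousWithinAt)
    (fun t ht => (hasDerivAt_comp hf hx (interior_subset ht)).hasDerivWithinAt)
    fun t _ => by positivity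

theorem comp_le_of_mem_omega (hf : ∀ p, AnalyticAt ℝ f p)
    (hx : ∀ t : ℝ, 0 ≤ t → HasDerivAt x (gradient f (x t)) t)
    (hp : p ∈ ⋂ T : ℝ, closure (x '' Set.Ici T)) {t : ℝ} (ht : 0 ≤ t) : f (x t) ≤ f p := by
  have hfc : Continuous f := continuous_iff_continuousAt.2 fun q => (hf q).continuousAt
  refine closure_minimal ?_ (isClosed_le continuous_const hfc) (Set.mem_iInter.1 hp t)
  rintro _ ⟨r, hr, rfl⟩
  exact monotoneOn_comp hf hx ht (ht.trans hr) hr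

theorem gradient_eq_zero_of_tendsto (hf : ∀ p, AnalyticAt ℝ f p)
    (hx : ∀ t : ℝ, 0 ≤ t → HasDerivAt x (gradient f (x t)) t)
    (h : Tendsto x atTop (𝓝 p)) : gradient f p = 0 := by
  have hmvt : ∀ n : ℕ, ∃ c : ℝ, (n : ℝ) < c ∧
      ‖gradient f (x c)‖ ^ 2 = f (x (n + 1)) - f (x n) := by
    intro n
    have hn : (0 : ℝ) ≤ n := n.cast_nonneg
    obtain ⟨c, hc, h⟩ := exists_hasDerivAt_eq_slope (fun t => f (x t))
      (fun t => ‖gradient f (x t)‖ ^ 2) (lt_add_one (n : ℝ))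
      (fun t ht => (hasDerivAt_comp hf hx (hn.trans ht.1)).continuousAt.continuousWithinAt)
      (fun t ht => hasDerivAt_comp hf hx (hn.trans ht.1.le))
    exact ⟨c, hc.1, by simpa using h⟩
  choose c hc hgrad using hmvt
  have hctop : Tendsto c atTop atTop :=
    tendsto_atTop_mono (fun n => (hc n).le) tendsto_natCast_atTop_atTop
  have h1 : Tendsto (fun n => ‖gradient f (x (c n))‖ ^ 2) atTop (𝓝 (‖gradient f p‖ ^ 2)) :=
    ((((continuous_gradient hf).tendsto p).comp (h.comp hctop)).norm).pow 2
  have hfx : Tendsto (fun t => f (x t)) atTop (𝓝 (f p)) := (hf p).continuousAt.tendsto.comp h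
  have h2 : Tendsto (fun n => ‖gradient f (x (c n))‖ ^ 2) atTop (𝓝 (f p - f p)) := by
    simp only [hgrad]
    exact (hfx.comp (tendsto_atTop_add_const_right _ _ tendsto_natCast_atTop_atTop)).sub
      (hfx.comp tendsto_natCast_atTop_atTop)
  simpa using tendsto_nhds_unique h1 h2

/-- A gradient flow line that reaches the limiting level of `f` is stationary from then on. -/
theorem exists_tendsto_of_comp_eq (hf : ∀ p, AnalyticAt ℝ f p)
    (hx : ∀ t : ℝ, 0 ≤ t → HasDerivAt x (gradient f (x t)) t)
    (hp : p ∈ ⋂ T : ℝ, closure (x '' Set.Ici T)) {s : ℝ} (hs : 0 ≤ s) (hfs : f (x s) = f p) :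
    ∃ q, Tendsto x atTop (𝓝 q) := by
  have hconst : ∀ t, s ≤ t → f (x t) = f p := fun t ht =>
    (comp_le_of_mem_omega hf hx hp (hs.trans ht)).antisymm
      (hfs ▸ monotoneOn_comp hf hx hs (hs.trans ht) ht)
  have hzero : ∀ t, s < t → gradient f (x t) = 0 := by
    intro t ht
    have h1 := hasDerivAt_comp hf hx (hs.trans ht.le)
    have h2 : HasDerivAt (fun t => f (x t)) 0 t :=
      (hasDerivAt_const t (f p)).congr_of_eventuallyEq
        ((eventually_gt_nhds ht).mono fun r hr => hconst r hr.le)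
    simpa using h1.unique h2
  refine ⟨x (s + 1), tendsto_const_nhds.congr' ?_⟩
  filter_upwards [eventually_ge_atTop (s + 1)] with t ht
  refine (constant_of_has_deriv_right_zero (f := x) (a := s + 1) (b := t)
    (fun r hr => (hx r (by linarith [hr.1])).continuousAt.continuousWithinAt)
    (fun r hr => ?_) t ⟨ht, le_rfl⟩).symm
  have h := hx r (by linarith [hr.1])
  rw [hzero r (by linarith [hr.1])] at h
  exact h.hasDerivWithinAt

theorem tendsto_of_comp_lt (hf : ∀ p, AnalyticAt ℝ f p)
    (hx : ∀ t : ℝ, 0 ≤ t → HasDerivAt x (gradient f (x t)) t)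
    (hp : p ∈ ⋂ T : ℝ, closure (x '' Set.Ici T)) (hlt : ∀ t, 0 ≤ t → f (x t) < f p) :
    Tendsto x atTop (𝓝 p) := by
  obtain ⟨m, C₀, hC₀⟩ := AnalyticGerm.lojasiewicz_gradient (hf p)
  obtain ⟨ρ, hρ, hball⟩ := Metric.eventually_nhds_iff.1 hC₀
  set C := |C₀|
  set e : ℝ := 1 / (m + 1) with he
  have he0 : 0 < e := by positivity
  set Φ : E → ℝ := fun y => (m + 1) * C * (f p - f y) ^ e with hΦ
  have hΦp : Φ p = 0 := by simp [hΦ, Real.zero_rpow he0.ne']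
  have hΦc : ContinuousAt Φ p :=
    ((continuousAt_const.sub (hf p).continuousAt).rpow_const (Or.inr he0.le)).const_mul _
  have hderiv : ∀ t, 0 ≤ t → HasDerivAt (fun t => Φ (x t))
      (-(C * (f p - f (x t)) ^ (e - 1) * ‖gradient f (x t)‖ ^ 2)) t := by
    intro t ht
    have h := (((hasDerivAt_comp hf hx ht).const_sub (f p)).rpow_const (p := e)
      (Or.inl (sub_pos.2 (hlt t ht)).ne')).const_mul ((m + 1) * C)
    refine h.congr_deriv ?_
    rw [he]
    field_simp
  have hspeed : ∀ t, 0 ≤ t → dist (x t) p < ρ →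
      ‖gradient f (x t)‖ ≤ C * (f p - f (x t)) ^ (e - 1) * ‖gradient f (x t)‖ ^ 2 := by
    intro t ht hd
    have hg := sub_pos.2 (hlt t ht)
    have h := (hball hd (sub_neg.2 (hlt t ht)).ne).trans
      (mul_le_mul_of_nonneg_right (le_abs_self C₀) (norm_nonneg _))
    rw [abs_sub_comm, abs_of_pos hg, ← norm_gradient_eq] at h
    have hexp : (f p - f (x t)) ^ (m / (m + 1) : ℝ) * (f p - f (x t)) ^ (e - 1) = 1 := by
      rw [← Real.rpow_add hg, he,
        show (m / (m + 1) : ℝ) + (1 / (m + 1) - 1) = 0 by field_simp; ring, Real.rpow_zero]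
    calc ‖gradient f (x t)‖
        = (f p - f (x t)) ^ (m / (m + 1) : ℝ) *
            ((f p - f (x t)) ^ (e - 1) * ‖gradient f (x t)‖) := by
          rw [← mul_assoc, hexp, one_mul]
      _ ≤ C * ‖gradient f (x t)‖ * ((f p - f (x t)) ^ (e - 1) * ‖gradient f (x t)‖) := by
          gcongr
      _ = _ := by ring
  refine Metric.tendsto_atTop.2 fun ε hε => ?_
  set r := min ε ρ / 2 with hr
  have hr0 : 0 < r := by positivity
  have hrε : r + r ≤ ε := by rw [hr, add_halves]; exact min_le_left _ _
  have hrρ : r + r ≤ ρ := by rw [hr, add_halves]; exact min_le_right _ _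
  obtain ⟨s, ⟨hsp, hsΦ⟩, hs⟩ := ((frequently_of_mem_omega hp
    ((Metric.eventually_nhds_iff.2 ⟨r, hr0, fun y hy => hy⟩).and
      (hΦc.eventually (gt_mem_nhds (hΦp ▸ hr0))))).and_eventually
        (eventually_ge_atTop 0)).exists
  refine ⟨s, fun b hb => ?_⟩
  obtain ⟨δ, hδ, hδr⟩ : ∃ δ > 0, Φ (x s) + δ * (b - s) < r := by
    have hbs : 0 < b - s + 1 := by linarith
    refine ⟨(r - Φ (x s)) / (b - s + 1), div_pos (sub_pos.2 hsΦ) hbs, ?_⟩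
    have h : (r - Φ (x s)) / (b - s + 1) * (b - s) < r - Φ (x s) := by
      rw [div_mul_eq_mul_div, div_lt_iff₀ hbs]
      nlinarith
    linarith
  have hΦ0 : ∀ t, 0 ≤ t → 0 ≤ Φ (x t) := fun t ht => by
    have := sub_pos.2 (hlt t ht)
    positivity
  set B : ℝ → ℝ := fun t => Φ (x s) - Φ (x t) + δ * (t - s) with hB
  have hBr : ∀ t ∈ Set.Icc s b, B t < r := by
    intro t ht
    have h1 := hΦ0 t (hs.trans ht.1)
    have h2 : δ * (t - s) ≤ δ * (b - s) := by gcongr; exact ht.2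
    simp only [hB]
    linarith
  have hBd : ∀ t, 0 ≤ t → HasDerivAt B
      (C * (f p - f (x t)) ^ (e - 1) * ‖gradient f (x t)‖ ^ 2 + δ) t := fun t ht =>
    (((hderiv t ht).const_sub (Φ (x s))).add
      (((hasDerivAt_id t).sub_const s).const_mul δ)).congr_deriv (by ring)
  have hnorm : ‖x b - x s‖ ≤ B b :=
    image_norm_le_of_norm_deriv_right_lt_deriv_boundary' (f := fun t => x t - x s)
      (fun t ht => ((hx t (hs.trans ht.1)).sub_const _).continuousAt.continuousWithinAt)
      (fun t ht => ((hx t (hs.trans ht.1)).sub_const _).hasDerivWithinAt)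
      (by simp [hB])
      (fun t ht => (hBd t (hs.trans ht.1)).continuousAt.continuousWithinAt)
      (fun t ht => (hBd t (hs.trans ht.1)).hasDerivWithinAt)
      (fun t ht heq => by
        have h1 : dist (x t) (x s) < r := by
          rw [dist_eq_norm, heq]
          exact hBr t (Set.Ico_subset_Icc_self ht)
        have h2 := hspeed t (hs.trans ht.1)
          ((dist_triangle _ _ _).trans_lt ((add_lt_add h1 hsp).trans_le hrρ))
        linarith)
      ⟨hb, le_rfl⟩
  have h1 : dist (x b) (x s) < r := by
    rw [dist_eq_norm]
    exact hnorm.trans_lt (hBr b ⟨hb, le_rfl⟩)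
  exact (dist_triangle _ _ _).trans_lt ((add_lt_add h1 hsp).trans_le hrε)

end

end GradientFlow

/-- Łojasiewicz convergence theorem for analytic gradient flows: if `f` is real analytic on
a finite-dimensional real inner product space and `x` is a solution of `ẋ = ∇f(x)` on
`[0,∞)` whose ω-limit set is nonempty, then the ω-limit set is a singleton `{p}` for a
critical point `p` of `f`, and `x(t) → p` as `t → ∞`. -/
theorem stmt14 (E : Type*) [NormedAddCommGroup E] [InnerProductSpace ℝ E]
    [FiniteDimensional ℝ E]
    (f : E → ℝ) (hf : ∀ p : E, AnalyticAt ℝ f p)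
    (x : ℝ → E) (hx : ∀ t : ℝ, 0 ≤ t → HasDerivAt x (gradient f (x t)) t)
    (hω : (⋂ T : ℝ, closure (x '' Set.Ici T)).Nonempty) :
    ∃ p : E, gradient f p = 0 ∧ Tendsto x atTop (𝓝 p) ∧
      (⋂ T : ℝ, closure (x '' Set.Ici T)) = {p} := by
  obtain ⟨p, hp⟩ := hω
  have hlim : Tendsto x atTop (𝓝 p) := by
    by_cases h : ∃ s, 0 ≤ s ∧ f (x s) = f p
    · obtain ⟨s, hs, hfs⟩ := h
      obtain ⟨q, hq⟩ := GradientFlow.exists_tendsto_of_comp_eq hf hx hp hs hfs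
      exact GradientFlow.eq_of_mem_omega_of_tendsto hp hq ▸ hq
    · push Not at h
      exact GradientFlow.tendsto_of_comp_lt hf hx hp fun t ht =>
        (GradientFlow.comp_le_of_mem_omega hf hx hp ht).lt_of_ne (h t ht)
  exact ⟨p, GradientFlow.gradient_eq_zero_of_tendsto hf hx hlim, hlim,
    Set.Subset.antisymm (fun q hq => GradientFlow.eq_of_mem_omega_of_tendsto hq hlim)
      (Set.singleton_subset_iff.2 hp)⟩
end
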